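/- arXiv:1011.2443 — 9 statements merged into one kernel-verified Lean document; each statement's English description precedes it below -/
import Mathlib

section
/- Let d ≥ 1 be an integer and let Q be a d×d matrix with nonnegative entries, zeros on the diagonal, and ‖Q‖_cs < 1. Let x : [0,∞) → ℝ^d be continuous with x_i(0) ≥ 0 for every i. Then there exists exactly one continuous function y : [0,∞) → ℝ^d satisfying y_i(t) = sup_{0≤s≤t} ((y(s)Q)_i − x_i(s))_+ for all t ≥ 0 and all i = 1,…,d. Moreover, the iterative scheme y^{[0]} ≡ 0, y^{[k+1]}_i(t) = sup_{0≤s≤t} ((y^{[k]}(s)Q)_i − x_i(s))_+ converges to y uniformly on every compact subinterval of [0,∞). -/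
open Set Filter Topology

/-- The running supremum of a function that is continuous on `[0, ∞)` is continuous there. -/
theorem ContinuousOn.runningSup {f : ℝ → ℝ} (hf : ContinuousOn f (Ici 0)) :
    ContinuousOn (fun t => ⨆ s : Icc (0 : ℝ) t, f s.1) (Ici 0) := by
  have hg : Continuous fun s => f (max 0 s) :=
    hf.comp_continuous (by fun_prop) fun s => le_max_left 0 s
  have hF : Continuous fun t : ℝ => sSup ((fun u : ℝ => f (max 0 (u * t))) '' Icc 0 1) :=
    isCompact_Icc.continuous_sSup (f := fun t u : ℝ => f (max 0 (u * t)))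
      (hg.comp (continuous_snd.mul continuous_fst))
  refine hF.continuousOn.congr fun t ht => ?_
  have ht : (0 : ℝ) ≤ t := ht
  change ⨆ s : Icc (0 : ℝ) t, f s.1 = _
  rw [← sSup_image' (f := f)]
  congr 1
  ext v
  constructor
  · rintro ⟨s, hs, rfl⟩
    refine ⟨s / t, ⟨div_nonneg hs.1 ht, div_le_one_of_le₀ hs.2 ht⟩, ?_⟩
    have : s / t * t = s := div_mul_cancel_of_imp fun h => le_antisymm (h ▸ hs.2) hs.1
    simp only [this, max_eq_right hs.1]
  · rintro ⟨u, hu, rfl⟩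
    have : 0 ≤ u * t := mul_nonneg hu.1 ht
    exact ⟨u * t, ⟨this, mul_le_of_le_one_left ht hu.2⟩, by simp only [max_eq_right this]⟩

/-- Suprema of two bounded families at uniform distance at most `c` are at distance at most `c`. -/
theorem abs_ciSup_sub_ciSup_le {ι : Type*} [Nonempty ι] {f g : ι → ℝ} {c : ℝ}
    (hf : BddAbove (range f)) (hg : BddAbove (range g)) (h : ∀ s, |f s - g s| ≤ c) :
    |(⨆ s, f s) - ⨆ s, g s| ≤ c := by
  rw [abs_sub_le_iff]
  constructor
  · rw [sub_le_iff_le_add]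
    exact ciSup_le fun s => by linarith [(abs_sub_le_iff.1 (h s)).1, le_ciSup hg s]
  · rw [sub_le_iff_le_add]
    exact ciSup_le fun s => by linarith [(abs_sub_le_iff.1 (h s)).2, le_ciSup hf s]

section SkorokhodStep

variable {d : ℕ} {Q : Matrix (Fin d) (Fin d) ℝ} {x y z : ℝ → Fin d → ℝ} {r : ℝ}

/-- The map whose fixed points are the local times of the Skorokhod problem. -/
noncomputable def skorokhodStep (Q : Matrix (Fin d) (Fin d) ℝ) (x y : ℝ → Fin d → ℝ) (t : ℝ)
    (i : Fin d) : ℝ :=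
  ⨆ s : Icc (0 : ℝ) t, max ((∑ j, y s.1 j * Q j i) - x s.1 i) 0

theorem continuousOn_skorokhodIntegrand (hx : ContinuousOn x (Ici 0)) (hy : ContinuousOn y (Ici 0))
    (i : Fin d) : ContinuousOn (fun s => max ((∑ j, y s j * Q j i) - x s i) 0) (Ici 0) := by
  rw [continuousOn_pi] at hx hy
  exact ((continuousOn_finsetSum _ fun j _ => (hy j).mul continuousOn_const).sub (hx i)).sup
    continuousOn_const

theorem continuousOn_skorokhodStep (hx : ContinuousOn x (Ici 0)) (hy : ContinuousOn y (Ici 0)) :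
    ContinuousOn (skorokhodStep Q x y) (Ici 0) :=
  continuousOn_pi.2 fun i => (continuousOn_skorokhodIntegrand hx hy i).runningSup

theorem bddAbove_skorokhodIntegrand (hx : ContinuousOn x (Ici 0)) (hy : ContinuousOn y (Ici 0))
    (t : ℝ) (i : Fin d) :
    BddAbove (range fun s : Icc (0 : ℝ) t => max ((∑ j, y s.1 j * Q j i) - x s.1 i) 0) := by
  have := isCompact_Icc.bddAbove_image
    ((continuousOn_skorokhodIntegrand (Q := Q) hx hy i).mono fun s (hs : s ∈ Icc 0 t) => hs.1)
  rwa [image_eq_range] at this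

/-- `skorokhodStep` contracts the uniform distance on `[0, t]` by the maximal column sum. -/
theorem dist_skorokhodStep_le (hQ : ∀ i, ∑ j, |Q j i| ≤ r) (hr : 0 ≤ r)
    (hx : ContinuousOn x (Ici 0)) (hy : ContinuousOn y (Ici 0)) (hz : ContinuousOn z (Ici 0))
    {t M : ℝ} (ht : 0 ≤ t) (h : ∀ s ∈ Icc 0 t, dist (y s) (z s) ≤ M) :
    dist (skorokhodStep Q x y t) (skorokhodStep Q x z t) ≤ r * M := by
  have hM : 0 ≤ M := dist_nonneg.trans (h 0 ⟨le_rfl, ht⟩)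
  have : Nonempty (Icc (0 : ℝ) t) := ⟨⟨0, le_rfl, ht⟩⟩
  refine (dist_pi_le_iff (mul_nonneg hr hM)).2 fun i => ?_
  refine abs_ciSup_sub_ciSup_le (bddAbove_skorokhodIntegrand hx hy t i)
    (bddAbove_skorokhodIntegrand hx hz t i) fun s => ?_
  refine (abs_max_sub_max_le_abs _ _ _).trans ?_
  rw [sub_sub_sub_cancel_right, ← Finset.sum_sub_distrib]
  calc |∑ j, (y s.1 j * Q j i - z s.1 j * Q j i)|
      ≤ ∑ j, |y s.1 j * Q j i - z s.1 j * Q j i| := Finset.abs_sum_le_sum_abs _ _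
    _ ≤ ∑ j, |Q j i| * M := by
        refine Finset.sum_le_sum fun j _ => ?_
        rw [← sub_mul, abs_mul, mul_comm]
        exact mul_le_mul_of_nonneg_left ((dist_le_pi_dist (y s.1) (z s.1) j).trans (h s.1 s.2))
          (abs_nonneg _)
    _ = (∑ j, |Q j i|) * M := (Finset.sum_mul _ _ _).symm
    _ ≤ r * M := mul_le_mul_of_nonneg_right (hQ i) hM

theorem exists_dist_le_on_Icc (hy : ContinuousOn y (Ici 0)) (hz : ContinuousOn z (Ici 0)) (T : ℝ) :
    ∃ M, ∀ s ∈ Icc 0 T, dist (y s) (z s) ≤ M := by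
  obtain ⟨M, hM⟩ := isCompact_Icc.bddAbove_image
    ((continuous_dist.comp_continuousOn (hy.prodMk hz)).mono fun s (hs : s ∈ Icc 0 T) => hs.1)
  exact ⟨M, fun s hs => hM (mem_image_of_mem _ hs)⟩

/-- Two sequences of iterates of `skorokhodStep` approach each other geometrically on `[0, T]`. -/
theorem dist_skorokhodStep_iterates_le (hQ : ∀ i, ∑ j, |Q j i| ≤ r) (hr : 0 ≤ r)
    (hx : ContinuousOn x (Ici 0)) {Y Z : ℕ → ℝ → Fin d → ℝ}
    (hY : ∀ k, ContinuousOn (Y k) (Ici 0)) (hZ : ∀ k, ContinuousOn (Z k) (Ici 0))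
    (hYs : ∀ k, EqOn (Y (k + 1)) (skorokhodStep Q x (Y k)) (Ici 0))
    (hZs : ∀ k, EqOn (Z (k + 1)) (skorokhodStep Q x (Z k)) (Ici 0))
    {T M : ℝ} (h : ∀ s ∈ Icc 0 T, dist (Y 0 s) (Z 0 s) ≤ M) (k : ℕ) :
    ∀ s ∈ Icc 0 T, dist (Y k s) (Z k s) ≤ M * r ^ k := by
  induction k with
  | zero => simpa using h
  | succ k ih =>
    intro s hs
    rw [hYs k hs.1, hZs k hs.1]
    refine (dist_skorokhodStep_le hQ hr hx (hY k) (hZ k) hs.1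
      fun u hu => ih u ⟨hu.1, hu.2.trans hs.2⟩).trans_eq ?_
    ring

theorem continuousOn_skorokhodStep_iterates (hx : ContinuousOn x (Ici 0))
    {Y : ℕ → ℝ → Fin d → ℝ} (hY0 : ContinuousOn (Y 0) (Ici 0))
    (hYs : ∀ k, EqOn (Y (k + 1)) (skorokhodStep Q x (Y k)) (Ici 0)) (k : ℕ) :
    ContinuousOn (Y k) (Ici 0) := by
  induction k with
  | zero => exact hY0
  | succ k ih => exact (continuousOn_skorokhodStep hx ih).congr (hYs k)

theorem tendstoUniformlyOn_of_dist_le_geometric {E : Type*} [PseudoMetricSpace E] {Y : ℕ → ℝ → E}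
    {y : ℝ → E} {S : Set ℝ} {C : ℝ} (hr : 0 ≤ r) (hr1 : r < 1)
    (h : ∀ k, ∀ s ∈ S, dist (Y k s) (y s) ≤ C * r ^ k) : TendstoUniformlyOn Y y atTop S := by
  have hlim : Tendsto (fun k => C * r ^ k) atTop (𝓝 0) := by
    simpa using (tendsto_pow_atTop_nhds_zero_of_lt_one hr hr1).const_mul C
  rw [Metric.tendstoUniformlyOn_iff]
  intro ε hε
  filter_upwards [hlim.eventually_lt_const hε] with k hk s hs
  rw [dist_comm]
  exact (h k s hs).trans_lt hk

theorem exists_skorokhodStep_fixedPoint (hQ : ∀ i, ∑ j, |Q j i| ≤ r) (hr : 0 ≤ r) (hr1 : r < 1)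
    (hx : ContinuousOn x (Ici 0)) :
    ∃ y, ContinuousOn y (Ici 0) ∧ EqOn y (skorokhodStep Q x y) (Ici 0) := by
  set Y : ℕ → ℝ → Fin d → ℝ := fun k => (skorokhodStep Q x)^[k] 0 with hYdef
  have hYs : ∀ k, Y (k + 1) = skorokhodStep Q x (Y k) := fun k =>
    Function.iterate_succ_apply' _ _ _
  have hY : ∀ k, ContinuousOn (Y k) (Ici 0) := continuousOn_skorokhodStep_iterates hx
    continuousOn_const fun k t _ => congrFun (hYs k) t
  have hgeom : ∀ T, ∃ M, ∀ s ∈ Icc 0 T, ∀ k, dist (Y k s) (Y (k + 1) s) ≤ M * r ^ k := by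
    intro T
    obtain ⟨M, hM⟩ := exists_dist_le_on_Icc (hY 0) (hY 1) T
    exact ⟨M, fun s hs k => dist_skorokhodStep_iterates_le hQ hr hx (Z := fun k => Y (k + 1)) hY
      (fun k => hY (k + 1)) (fun k t _ => congrFun (hYs k) t)
      (fun k t _ => congrFun (hYs (k + 1)) t) hM k s hs⟩
  have hlim : ∀ t, ∃ a, 0 ≤ t → Tendsto (fun k => Y k t) atTop (𝓝 a) := by
    intro t
    by_cases ht : 0 ≤ t
    · obtain ⟨M, hM⟩ := hgeom t
      obtain ⟨a, ha⟩ := cauchySeq_tendsto_of_complete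
        (cauchySeq_of_le_geometric r M hr1 (hM t ⟨ht, le_rfl⟩))
      exact ⟨a, fun _ => ha⟩
    · exact ⟨0, fun h => absurd h ht⟩
  choose y hy using hlim
  have hdist : ∀ T, ∃ C, ∀ k, ∀ s ∈ Icc 0 T, dist (Y k s) (y s) ≤ C * r ^ k := by
    intro T
    obtain ⟨M, hM⟩ := hgeom T
    refine ⟨M / (1 - r), fun k s hs => ?_⟩
    refine (dist_le_of_le_geometric_of_tendsto r M hr1 (hM s hs) (hy s hs.1) k).trans_eq ?_
    ring
  have hyc : ContinuousOn y (Ici 0) := by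
    have hloc : TendstoLocallyUniformlyOn Y y atTop (Ici 0) := by
      refine tendstoLocallyUniformlyOn_of_forall_exists_nhds fun t ht => ?_
      obtain ⟨C, hC⟩ := hdist (t + 1)
      refine ⟨Icc 0 (t + 1), ?_, tendstoUniformlyOn_of_dist_le_geometric hr hr1 hC⟩
      rw [← Ici_inter_Iic]
      exact inter_mem_nhdsWithin _ (Iic_mem_nhds (lt_add_one t))
    exact hloc.continuousOn (Frequently.of_forall hY)
  refine ⟨y, hyc, fun t ht => tendsto_nhds_unique ((hy t ht).comp (tendsto_add_atTop_nat 1)) ?_⟩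
  obtain ⟨C, hC⟩ := hdist t
  have hbound : ∀ k, dist (Y (k + 1) t) (skorokhodStep Q x y t) ≤ r * (C * r ^ k) := by
    intro k
    rw [hYs k]
    exact dist_skorokhodStep_le hQ hr hx (hY k) hyc ht (hC k)
  refine tendsto_iff_dist_tendsto_zero.2 (squeeze_zero (fun _ => dist_nonneg) hbound ?_)
  simpa using ((tendsto_pow_atTop_nhds_zero_of_lt_one hr hr1).const_mul C).const_mul r

theorem tendstoUniformlyOn_skorokhodStep_iterates (hQ : ∀ i, ∑ j, |Q j i| ≤ r) (hr : 0 ≤ r)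
    (hr1 : r < 1) (hx : ContinuousOn x (Ici 0)) (hy : ContinuousOn y (Ici 0))
    (hfix : EqOn y (skorokhodStep Q x y) (Ici 0)) {Y : ℕ → ℝ → Fin d → ℝ}
    (hY0 : ContinuousOn (Y 0) (Ici 0))
    (hYs : ∀ k, EqOn (Y (k + 1)) (skorokhodStep Q x (Y k)) (Ici 0)) (T : ℝ) :
    TendstoUniformlyOn Y y atTop (Icc 0 T) := by
  obtain ⟨M, hM⟩ := exists_dist_le_on_Icc hY0 hy T
  exact tendstoUniformlyOn_of_dist_le_geometric hr hr1
    (dist_skorokhodStep_iterates_le hQ hr hx (Z := fun _ => y)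
      (continuousOn_skorokhodStep_iterates hx hY0 hYs) (fun _ => hy) hYs (fun _ => hfix) hM)

end SkorokhodStep

/-- Existence and uniqueness of the "local time" part of the
Skorokhod map of Harrison–Reiman, as a fixed point of
`y_i(t) = sup_{0 ≤ s ≤ t} ((y(s)Q)_i − x_i(s))₊`, together with the locally
uniform convergence of the iterative scheme. -/
theorem skorokhod_fixed_point_exists_unique_and_iteration_converges
    (d : ℕ) (hd : 1 ≤ d) (Q : Matrix (Fin d) (Fin d) ℝ)
    (hQnn : ∀ i j, 0 ≤ Q i j) (hQdiag : ∀ i, Q i i = 0)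
    (hQcs : (⨆ j : Fin d, ∑ i : Fin d, |Q i j|) < 1)
    (x : ℝ → Fin d → ℝ) (hx : ContinuousOn x (Set.Ici 0))
    (hx0 : ∀ i, 0 ≤ x 0 i) :
    ∃ y : ℝ → Fin d → ℝ,
      ContinuousOn y (Set.Ici 0) ∧
      (∀ t ∈ Set.Ici (0 : ℝ), ∀ i, y t i =
        ⨆ s : Set.Icc (0 : ℝ) t, max ((∑ j, y s.1 j * Q j i) - x s.1 i) 0) ∧
      (∀ y' : ℝ → Fin d → ℝ, ContinuousOn y' (Set.Ici 0) →
        (∀ t ∈ Set.Ici (0 : ℝ), ∀ i, y' t i =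
          ⨆ s : Set.Icc (0 : ℝ) t, max ((∑ j, y' s.1 j * Q j i) - x s.1 i) 0) →
        Set.EqOn y' y (Set.Ici 0)) ∧
      (∀ Y : ℕ → ℝ → Fin d → ℝ,
        (∀ t i, Y 0 t i = 0) →
        (∀ k, ∀ t ∈ Set.Ici (0 : ℝ), ∀ i, Y (k + 1) t i =
          ⨆ s : Set.Icc (0 : ℝ) t, max ((∑ j, Y k s.1 j * Q j i) - x s.1 i) 0) →
        ∀ S : Set ℝ, IsCompact S → S ⊆ Set.Ici 0 →
          TendstoUniformlyOn Y y Filter.atTop S) := by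
  set r := ⨆ j : Fin d, ∑ i : Fin d, |Q i j| with hrdef
  have hr : 0 ≤ r := Real.iSup_nonneg fun j => Finset.sum_nonneg fun i _ => abs_nonneg _
  have hQ : ∀ i, ∑ j, |Q j i| ≤ r := fun i =>
    le_ciSup (f := fun j : Fin d => ∑ i : Fin d, |Q i j|) (finite_range _).bddAbove i
  obtain ⟨y, hy, hfix⟩ := exists_skorokhodStep_fixedPoint hQ hr hQcs hx
  refine ⟨y, hy, fun t ht i => congrFun (hfix ht) i, fun y' hy' hfix' t ht => ?_,
    fun Y hY0 hYs S hS hS0 => ?_⟩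
  · have hlim := tendstoUniformlyOn_skorokhodStep_iterates hQ hr hQcs hx hy hfix
      (Y := fun _ => y') hy' (fun _ t ht => funext fun i => hfix' t ht i) t
    exact tendsto_nhds_unique tendsto_const_nhds (hlim.tendsto_at ⟨ht, le_rfl⟩)
  · have hY0 : Y 0 = 0 := funext fun t => funext fun i => hY0 t i
    obtain ⟨T, hT⟩ := hS.bddAbove
    exact (tendstoUniformlyOn_skorokhodStep_iterates hQ hr hQcs hx hy hfix
      (by rw [hY0]; exact continuousOn_const)
      (fun k t ht => funext fun i => hYs k t ht i) T).mono fun s hs => ⟨hS0 hs, hT hs⟩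
end

section
/- Let T > 0, let d ≥ 1 be an integer, and let Q be a d×d matrix with nonnegative entries and ‖Q‖_cs < 1. Let g, g̃ ∈ C([0,T],ℝ^d) and suppose f, f̃ ∈ C([0,T],ℝ^d) satisfy the fixed-point equations f_i(t) = sup_{0≤s≤t} ((f(s)Q)_i − g_i(s))_+ and f̃_i(t) = sup_{0≤s≤t} ((f̃(s)Q)_i − g̃_i(s))_+ for all t ∈ [0,T] and i = 1,…,d. Then ‖f − f̃‖_{T,max} ≤ (1 − ‖Q‖_cs)^{−1} · ‖g − g̃‖_{T,max}. -/
open scoped BigOperators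

/-- The `‖·‖_{T,max}` norm of a path `f : [0,T] → ℝ^d`. -/
noncomputable def normTmax (T : ℝ) {d : ℕ} (f : ℝ → Fin d → ℝ) : ℝ :=
  ⨆ i : Fin d, ⨆ t : Set.Icc (0 : ℝ) T, |f t.1 i|

/-- The maximal column sum norm `‖Q‖_cs` of a `d × d` matrix. -/
noncomputable def csNorm {d : ℕ} (Q : Matrix (Fin d) (Fin d) ℝ) : ℝ :=
  ⨆ j : Fin d, ∑ i : Fin d, |Q i j|

/-- Suprema of two uniformly `c`-close bounded families differ by at most `c`. -/
lemma abs_iSup_sub_iSup_le {ι : Type*} [Nonempty ι] {a b : ι → ℝ} {c : ℝ}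
    (ha : BddAbove (Set.range a)) (hb : BddAbove (Set.range b))
    (h : ∀ s, |a s - b s| ≤ c) : |(⨆ s, a s) - ⨆ s, b s| ≤ c := by
  rw [abs_sub_le_iff]
  constructor
  · rw [sub_le_iff_le_add]
    refine ciSup_le fun s => ?_
    linarith [(abs_sub_le_iff.1 (h s)).1, le_ciSup hb s]
  · rw [sub_le_iff_le_add]
    refine ciSup_le fun s => ?_
    linarith [(abs_sub_le_iff.1 (h s)).2, le_ciSup ha s]

lemma bddAbove_range_Icc_of_continuousOn {T t : ℝ} (ht : t ≤ T) {u : ℝ → ℝ}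
    (hu : ContinuousOn u (Set.Icc 0 T)) :
    BddAbove (Set.range fun s : Set.Icc (0 : ℝ) t => u s.1) := by
  refine (isCompact_Icc.bddAbove_image hu).mono ?_
  rintro _ ⟨s, rfl⟩
  exact ⟨s.1, ⟨s.2.1, s.2.2.trans ht⟩, rfl⟩

lemma abs_apply_le_normTmax {T : ℝ} {d : ℕ} {f : ℝ → Fin d → ℝ}
    (hf : ContinuousOn f (Set.Icc 0 T)) {t : ℝ} (ht : t ∈ Set.Icc 0 T) (i : Fin d) :
    |f t i| ≤ normTmax T f :=
  calc |f t i| ≤ ⨆ s : Set.Icc (0 : ℝ) T, |f s.1 i| :=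
        le_ciSup (f := fun s : Set.Icc (0 : ℝ) T => |f s.1 i|)
          (bddAbove_range_Icc_of_continuousOn le_rfl (continuousOn_pi.1 hf i).abs) ⟨t, ht⟩
    _ ≤ normTmax T f :=
        le_ciSup (f := fun j : Fin d => ⨆ s : Set.Icc (0 : ℝ) T, |f s.1 j|)
          (Set.finite_range _).bddAbove i

lemma normTmax_le {T : ℝ} (hT : 0 ≤ T) {d : ℕ} [NeZero d] {f : ℝ → Fin d → ℝ} {c : ℝ}
    (h : ∀ t ∈ Set.Icc 0 T, ∀ i, |f t i| ≤ c) : normTmax T f ≤ c := by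
  have : Nonempty (Set.Icc 0 T) := ⟨⟨0, le_rfl, hT⟩⟩
  exact ciSup_le fun i => ciSup_le fun t => h t.1 t.2 i

lemma normTmax_nonneg (T : ℝ) {d : ℕ} (f : ℝ → Fin d → ℝ) : 0 ≤ normTmax T f :=
  Real.iSup_nonneg fun _ => Real.iSup_nonneg fun _ => abs_nonneg _

lemma sum_abs_col_le_csNorm {d : ℕ} (Q : Matrix (Fin d) (Fin d) ℝ) (j : Fin d) :
    ∑ i, |Q i j| ≤ csNorm Q :=
  le_ciSup (f := fun j : Fin d => ∑ i, |Q i j|) (Set.finite_range _).bddAbove j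

lemma abs_sum_mul_le_csNorm_mul {d : ℕ} (Q : Matrix (Fin d) (Fin d) ℝ) {y : Fin d → ℝ} {c : ℝ}
    (hc : 0 ≤ c) (hy : ∀ j, |y j| ≤ c) (i : Fin d) : |∑ j, y j * Q j i| ≤ csNorm Q * c :=
  calc |∑ j, y j * Q j i| ≤ ∑ j, |y j * Q j i| := Finset.abs_sum_le_sum_abs _ _
    _ ≤ ∑ j, |Q j i| * c := by
        refine Finset.sum_le_sum fun j _ => ?_
        rw [abs_mul, mul_comm]
        exact mul_le_mul_of_nonneg_left (hy j) (abs_nonneg _)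
    _ = (∑ j, |Q j i|) * c := (Finset.sum_mul _ _ _).symm
    _ ≤ csNorm Q * c := mul_le_mul_of_nonneg_right (sum_abs_col_le_csNorm Q i) hc

lemma continuousOn_reflected_input {S : Set ℝ} {d : ℕ} (Q : Matrix (Fin d) (Fin d) ℝ)
    {f g : ℝ → Fin d → ℝ} (hf : ContinuousOn f S) (hg : ContinuousOn g S) (i : Fin d) :
    ContinuousOn (fun s => max ((∑ j, f s j * Q j i) - g s i) 0) S := by
  have hfi := continuousOn_pi.1 hf
  have hgi := continuousOn_pi.1 hg i
  exact ((continuousOn_finsetSum _ fun j _ => (hfi j).mul continuousOn_const).sub hgi).sup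
    continuousOn_const

/-- fixed points of the Skorokhod iteration map depend Lipschitz
continuously (with constant `(1 − ‖Q‖_cs)⁻¹`) on the input path. -/
theorem fixed_point_lipschitz_in_input
    (T : ℝ) (hT : 0 < T) (d : ℕ) (hd : 1 ≤ d)
    (Q : Matrix (Fin d) (Fin d) ℝ) (hQnn : ∀ i j, 0 ≤ Q i j)
    (hQcs : csNorm Q < 1)
    (g g' f f' : ℝ → Fin d → ℝ)
    (hg : ContinuousOn g (Set.Icc 0 T)) (hg' : ContinuousOn g' (Set.Icc 0 T))
    (hf : ContinuousOn f (Set.Icc 0 T)) (hf' : ContinuousOn f' (Set.Icc 0 T))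
    (hfe : ∀ t ∈ Set.Icc (0 : ℝ) T, ∀ i, f t i =
      ⨆ s : Set.Icc (0 : ℝ) t, max ((∑ j, f s.1 j * Q j i) - g s.1 i) 0)
    (hfe' : ∀ t ∈ Set.Icc (0 : ℝ) T, ∀ i, f' t i =
      ⨆ s : Set.Icc (0 : ℝ) t, max ((∑ j, f' s.1 j * Q j i) - g' s.1 i) 0) :
    normTmax T (fun t i => f t i - f' t i) ≤
      (1 - csNorm Q)⁻¹ * normTmax T (fun t i => g t i - g' t i) := by
  have : NeZero d := ⟨by omega⟩
  set N := normTmax T (fun t i => f t i - f' t i)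
  set M := normTmax T (fun t i => g t i - g' t i)
  have hN : N ≤ csNorm Q * N + M := by
    refine normTmax_le hT.le fun t ht i => ?_
    have : Nonempty (Set.Icc 0 t) := ⟨⟨0, le_rfl, ht.1⟩⟩
    rw [hfe t ht i, hfe' t ht i]
    refine abs_iSup_sub_iSup_le
      (bddAbove_range_Icc_of_continuousOn ht.2 (continuousOn_reflected_input Q hf hg i))
      (bddAbove_range_Icc_of_continuousOn ht.2 (continuousOn_reflected_input Q hf' hg' i))
      fun s => ?_
    have hs : s.1 ∈ Set.Icc 0 T := ⟨s.2.1, s.2.2.trans ht.2⟩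
    have hsum : |∑ j, (f s.1 j - f' s.1 j) * Q j i| ≤ csNorm Q * N :=
      abs_sum_mul_le_csNorm_mul Q (normTmax_nonneg T _)
        (fun j => abs_apply_le_normTmax (hf.sub hf') hs j) i
    have hgs : |g s.1 i - g' s.1 i| ≤ M := abs_apply_le_normTmax (hg.sub hg') hs i
    calc _ ≤ |((∑ j, f s.1 j * Q j i) - g s.1 i) - ((∑ j, f' s.1 j * Q j i) - g' s.1 i)| :=
          abs_max_sub_max_le_abs _ _ _
      _ = |(∑ j, (f s.1 j - f' s.1 j) * Q j i) - (g s.1 i - g' s.1 i)| := by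
          simp only [sub_mul, Finset.sum_sub_distrib]
          congr 1
          ring
      _ ≤ csNorm Q * N + M := (abs_sub _ _).trans (add_le_add hsum hgs)
  rw [inv_mul_eq_div, le_div_iff₀ (sub_pos.2 hQcs)]
  linarith
end

section
/- Let K ≥ 2 be an integer and let w : [0,1] → ℝ be strictly concave with w(0) = w(1) = 0 and w > 0 on (0,1). Let D be the (K−1)×(K−1) diagonal matrix with diagonal entries w(1/K), w(2/K), …, w((K−1)/K), and set R = D Q^{(K−1)} D^{−1}. Then ‖R‖_cs = max_{l=1,…,K−1} (w((l−1)/K) + w((l+1)/K)) / (2 w(l/K)), and this quantity is strictly less than 1. -/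
open scoped BigOperators

/-- Summing the values of `f` over the neighbours of `j` in a path, when `f` vanishes just
outside both ends of the path. -/
theorem sum_ite_natDist_eq_one {n : ℕ} (f : ℕ → ℝ) (hf0 : f 0 = 0) (hfn : f (n + 1) = 0)
    (j : Fin n) :
    ∑ i : Fin n, (if Nat.dist (i : ℕ) (j : ℕ) = 1 then f (i + 1) else 0) = f j + f (j + 2) := by
  obtain ⟨j, hj⟩ := j
  rw [Fin.sum_univ_eq_sum_range (fun i => if Nat.dist i j = 1 then f (i + 1) else 0)]
  have split : ∀ i, (if Nat.dist i j = 1 then f (i + 1) else 0) =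
      (if i + 1 = j then f (i + 1) else 0) + (if i = j + 1 then f (i + 1) else 0) := by
    intro i
    unfold Nat.dist
    split_ifs <;> first | omega | simp
  simp_rw [split, Finset.sum_add_distrib, Finset.sum_ite_eq', Finset.mem_range]
  congr 1
  · cases j with
    | zero => simp [hf0]
    | succ k =>
      simp_rw [Nat.add_right_cancel_iff, Finset.sum_ite_eq', Finset.mem_range]
      rw [if_pos (by omega)]
  · split_ifs with h
    · rfl
    · rw [show j + 2 = n + 1 by omega, hfn]

/-- Column sums of the path adjacency weights `1 / 2` conjugated by a positive diagonal matrix. -/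
theorem sum_abs_diagonal_conj_path {n : ℕ} (f : ℕ → ℝ) (hf0 : f 0 = 0) (hfn : f (n + 1) = 0)
    (hpos : ∀ i : Fin n, 0 < f (i + 1)) (j : Fin n) :
    ∑ i : Fin n, |(Matrix.diagonal (fun i : Fin n => f (i + 1)) *
      (Matrix.of fun i j : Fin n => if Nat.dist (i : ℕ) (j : ℕ) = 1 then (1 / 2 : ℝ) else 0) *
      (Matrix.diagonal fun i : Fin n => f (i + 1))⁻¹) i j| =
      (f j + f (j + 2)) / (2 * f (j + 1)) := by
  have hinv : (Matrix.diagonal fun i : Fin n => f (i + 1))⁻¹ =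
      Matrix.diagonal fun i : Fin n => (f (i + 1))⁻¹ := by
    apply Matrix.inv_eq_right_inv
    rw [Matrix.diagonal_mul_diagonal, ← Matrix.diagonal_one]
    congr 1
    funext i
    exact mul_inv_cancel₀ (hpos i).ne'
  rw [← sum_ite_natDist_eq_one f hf0 hfn j, hinv, Finset.sum_div]
  refine Finset.sum_congr rfl fun i _ => ?_
  rw [Matrix.mul_diagonal, Matrix.diagonal_mul, Matrix.of_apply]
  have hi := hpos i
  have hj := hpos j
  split_ifs
  · rw [abs_of_pos (by positivity)]
    field_simp
  · simp

/-- A strictly concave function lies strictly above the average of its values at two points,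
evaluated at their midpoint. -/
theorem StrictConcaveOn.add_lt_two_mul_midpoint {s : Set ℝ} {w : ℝ → ℝ}
    (hw : StrictConcaveOn ℝ s w) {x y z : ℝ} (hx : x ∈ s) (hy : y ∈ s) (hxy : x ≠ y)
    (hz : x + y = 2 * z) : w x + w y < 2 * w z := by
  have h := hw.2 hx hy hxy (one_half_pos (α := ℝ)) one_half_pos (add_halves 1)
  simp only [smul_eq_mul] at h
  rw [show 1 / 2 * x + 1 / 2 * y = z by linarith] at h
  linarith

/-- for the tridiagonal reflection matrix `Q^{(K−1)}` and a diagonal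
rescaling `D` built from a strictly concave function `w` vanishing exactly at `0`
and `1`, the column-sum norm of `R = D Q^{(K−1)} D⁻¹` equals
`max_l (w((l−1)/K) + w((l+1)/K)) / (2 w(l/K))`, which is strictly less than `1`. -/
theorem csNorm_of_rescaled_reflection_matrix
    (K : ℕ) (hK : 2 ≤ K) (w : ℝ → ℝ)
    (hconc : StrictConcaveOn ℝ (Set.Icc 0 1) w)
    (hw0 : w 0 = 0) (hw1 : w 1 = 0)
    (hwpos : ∀ u ∈ Set.Ioo (0 : ℝ) 1, 0 < w u)
    (D R : Matrix (Fin (K - 1)) (Fin (K - 1)) ℝ)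
    (hD : D = Matrix.diagonal fun i : Fin (K - 1) => w ((((i : ℕ) : ℝ) + 1) / K))
    (hR : R = D * (Matrix.of fun i j : Fin (K - 1) =>
      if Nat.dist (i : ℕ) (j : ℕ) = 1 then (1 / 2 : ℝ) else 0) * D⁻¹) :
    (⨆ j : Fin (K - 1), ∑ i : Fin (K - 1), |R i j|) =
      (⨆ l : Fin (K - 1),
        (w (((l : ℕ) : ℝ) / K) + w ((((l : ℕ) : ℝ) + 2) / K)) /
          (2 * w ((((l : ℕ) : ℝ) + 1) / K))) ∧
    (⨆ j : Fin (K - 1), ∑ i : Fin (K - 1), |R i j|) < 1 := by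
  have hK0 : (0 : ℝ) < K := by exact_mod_cast (by omega : 0 < K)
  have hpos : ∀ i : Fin (K - 1), 0 < w ((((i : ℕ) : ℝ) + 1) / K) := by
    intro i
    refine hwpos _ ⟨by positivity, ?_⟩
    rw [div_lt_one hK0]
    exact_mod_cast (by omega : (i : ℕ) + 1 < K)
  have hsum : ∀ j : Fin (K - 1), ∑ i : Fin (K - 1), |R i j| =
      (w (((j : ℕ) : ℝ) / K) + w ((((j : ℕ) : ℝ) + 2) / K)) /
        (2 * w ((((j : ℕ) : ℝ) + 1) / K)) := by
    intro j
    have h := sum_abs_diagonal_conj_path (n := K - 1) (fun m => w ((m : ℝ) / K))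
      (by simpa using hw0)
      (by rw [Nat.sub_add_cancel (by omega : 1 ≤ K), div_self hK0.ne', hw1])
      (fun i => by simpa using hpos i) j
    rw [hR, hD]
    simpa only [Nat.cast_add, Nat.cast_one, Nat.cast_ofNat] using h
  refine ⟨iSup_congr hsum, ?_⟩
  have : Nonempty (Fin (K - 1)) := ⟨⟨0, by omega⟩⟩
  obtain ⟨j, hj⟩ := exists_eq_ciSup_of_finite (f := fun j : Fin (K - 1) => ∑ i, |R i j|)
  rw [← hj, hsum j, div_lt_one (mul_pos two_pos (hpos j))]
  have hjK : ((j : ℕ) : ℝ) + 2 ≤ K := by exact_mod_cast (by omega : (j : ℕ) + 2 ≤ K)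
  apply hconc.add_lt_two_mul_midpoint
  · exact ⟨by positivity, by rw [div_le_one hK0]; linarith⟩
  · exact ⟨by positivity, by rwa [div_le_one hK0]⟩
  · intro h
    rw [div_left_inj' hK0.ne'] at h
    linarith
  · ring
end

section
/- Let K ≥ 4 be an integer and let v : [0,1] → ℝ be continuous with v(1/2) = 0, v(x) = −v(1−x) for all x ∈ [0,1], and v strictly decreasing and convex on [0,1/2]. Set w(x) = ∫_0^x v(y) dy. Then the maximum over l = 1,…,K−1 of (w((l−1)/K) + w((l+1)/K)) / (2 w(l/K)) is attained at an index l minimizing |l/K − 1/2|. In particular: if K is even, the maximum equals 1 − (∫_{1/2−1/K}^{1/2} v(y) dy) / (∫_0^{1/2} v(y) dy); if K is odd, the maximum is attained at l = (K−1)/2 and is at most 1 − (∫_{(K−2)/(2K)}^{1/2} v(y) dy) / (2 ∫_0^{1/2} v(y) dy). -/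
open scoped BigOperators

/-- `w(x) = ∫_0^x v(y) dy`. -/
noncomputable def wInt (v : ℝ → ℝ) (x : ℝ) : ℝ := ∫ y in (0 : ℝ)..x, v y

/-- The column-sum ratio `(w((l−1)/K) + w((l+1)/K)) / (2 w(l/K))`. -/
noncomputable def colRatio (v : ℝ → ℝ) (K : ℕ) (l : ℕ) : ℝ :=
  (wInt v (((l : ℝ) - 1) / K) + wInt v (((l : ℝ) + 1) / K)) /
    (2 * wInt v ((l : ℝ) / K))

theorem ConvexOn.map_add_map_le_of_add_eq {S : Set ℝ} {f : ℝ → ℝ} (hf : ConvexOn ℝ S f)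
    {a b c d : ℝ} (ha : a ∈ S) (hd : d ∈ S) (hab : a ≤ b) (hbd : b ≤ d) (h : a + d = b + c) :
    f b + f c ≤ f a + f d := by
  rcases (hab.trans hbd).eq_or_lt with had | had
  · have hb : b = a := by linarith
    have hc : c = d := by linarith
    rw [hb, hc]
  · have hpos : 0 < d - a := sub_pos.2 had
    have hp : 0 ≤ (d - b) / (d - a) := div_nonneg (by linarith) hpos.le
    have hq : 0 ≤ (b - a) / (d - a) := div_nonneg (by linarith) hpos.le
    have hpq : (d - b) / (d - a) + (b - a) / (d - a) = 1 := by field_simp; ring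
    have hb := hf.2 ha hd hp hq hpq
    have hc := hf.2 ha hd hq hp (by rw [add_comm]; exact hpq)
    have eb : (d - b) / (d - a) * a + (b - a) / (d - a) * d = b := by field_simp; ring
    have ec : (b - a) / (d - a) * a + (d - b) / (d - a) * d = c := by
      obtain rfl : c = a + d - b := by linarith
      field_simp; ring
    simp only [smul_eq_mul, eb, ec] at hb hc
    linear_combination hb + hc + (f a + f d) * hpq

section Antisymmetric

variable {v : ℝ → ℝ}

theorem ContinuousOn.intervalIntegrable_of_mem_unitInterval
    (hcont : ContinuousOn v (Set.Icc 0 1)) {a b : ℝ} (ha : a ∈ Set.Icc (0 : ℝ) 1)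
    (hb : b ∈ Set.Icc (0 : ℝ) 1) : IntervalIntegrable v MeasureTheory.volume a b :=
  (hcont.mono (Set.uIcc_subset_Icc ha hb)).intervalIntegrable

theorem wInt_sub (hcont : ContinuousOn v (Set.Icc 0 1)) {a b : ℝ}
    (ha : a ∈ Set.Icc (0 : ℝ) 1) (hb : b ∈ Set.Icc (0 : ℝ) 1) :
    wInt v b - wInt v a = ∫ y in a..b, v y :=
  intervalIntegral.integral_interval_sub_left
    (hcont.intervalIntegrable_of_mem_unitInterval (by simp) hb)
    (hcont.intervalIntegrable_of_mem_unitInterval (by simp) ha)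

theorem integral_eq_zero_of_antisymm (hsym : ∀ x ∈ Set.Icc (0 : ℝ) 1, v x = -v (1 - x))
    {x : ℝ} (hx : x ∈ Set.Icc (0 : ℝ) 1) : ∫ y in x..(1 - x), v y = 0 := by
  have h1 : ∫ y in x..(1 - x), v (1 - y) = ∫ y in x..(1 - x), v y := by
    rw [intervalIntegral.integral_comp_sub_left]
    simp
  have h2 : ∫ y in x..(1 - x), v y = ∫ y in x..(1 - x), -v (1 - y) := by
    refine intervalIntegral.integral_congr fun y hy => hsym y ?_
    exact Set.uIcc_subset_Icc hx ⟨by linarith [hx.2], by linarith [hx.1]⟩ hy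
  rw [intervalIntegral.integral_neg, h1] at h2
  linarith

theorem wInt_one_sub (hcont : ContinuousOn v (Set.Icc 0 1))
    (hsym : ∀ x ∈ Set.Icc (0 : ℝ) 1, v x = -v (1 - x)) {x : ℝ} (hx : x ∈ Set.Icc (0 : ℝ) 1) :
    wInt v (1 - x) = wInt v x := by
  have h := wInt_sub hcont hx (b := 1 - x) ⟨by linarith [hx.2], by linarith [hx.1]⟩
  rw [integral_eq_zero_of_antisymm hsym hx] at h
  linarith

theorem two_mul_wInt_sub (hcont : ContinuousOn v (Set.Icc 0 1)) {x h : ℝ} (hh : 0 ≤ h)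
    (h0 : 0 ≤ x - h) (h1 : x + h ≤ 1) :
    2 * wInt v x - (wInt v (x - h) + wInt v (x + h)) =
      ∫ s in (0 : ℝ)..h, (v (x - s) - v (x + s)) := by
  have ha : x - h ∈ Set.Icc (0 : ℝ) 1 := ⟨h0, by linarith⟩
  have hb : x ∈ Set.Icc (0 : ℝ) 1 := ⟨by linarith, by linarith⟩
  have hc : x + h ∈ Set.Icc (0 : ℝ) 1 := ⟨by linarith, h1⟩
  have hi1 := (hcont.intervalIntegrable_of_mem_unitInterval hb ha).comp_sub_left x
  have hi2 := (hcont.intervalIntegrable_of_mem_unitInterval hb hc).comp_add_left x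
  simp only [sub_self, sub_sub_cancel, add_sub_cancel_left] at hi1 hi2
  rw [intervalIntegral.integral_sub hi1 hi2, intervalIntegral.integral_comp_sub_left,
    intervalIntegral.integral_comp_add_left, sub_zero, add_zero, ← wInt_sub hcont ha hb,
    ← wInt_sub hcont hb hc]
  ring

theorem nonneg_of_mem_left_half (hhalf : v (1 / 2) = 0)
    (hanti : StrictAntiOn v (Set.Icc 0 (1 / 2))) {x : ℝ} (hx : x ∈ Set.Icc (0 : ℝ) (1 / 2)) :
    0 ≤ v x := by
  rw [← hhalf]
  exact hanti.antitoneOn hx (by norm_num) hx.2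

theorem wInt_mono_left_half (hcont : ContinuousOn v (Set.Icc 0 1)) (hhalf : v (1 / 2) = 0)
    (hanti : StrictAntiOn v (Set.Icc 0 (1 / 2))) {x y : ℝ} (hx : 0 ≤ x) (hxy : x ≤ y)
    (hy : y ≤ 1 / 2) : wInt v x ≤ wInt v y := by
  rw [← sub_nonneg, wInt_sub hcont ⟨hx, by linarith⟩ ⟨by linarith, by linarith⟩]
  exact intervalIntegral.integral_nonneg hxy fun u hu =>
    nonneg_of_mem_left_half hhalf hanti ⟨hx.trans hu.1, hu.2.trans hy⟩

theorem wInt_pos_left_half (hcont : ContinuousOn v (Set.Icc 0 1)) (hhalf : v (1 / 2) = 0)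
    (hanti : StrictAntiOn v (Set.Icc 0 (1 / 2))) {x : ℝ} (hx : 0 < x) (hx' : x ≤ 1 / 2) :
    0 < wInt v x := by
  refine intervalIntegral.intervalIntegral_pos_of_pos_on
    (hcont.intervalIntegrable_of_mem_unitInterval (by simp) ⟨hx.le, by linarith⟩)
    (fun u hu => ?_) hx
  rw [← hhalf]
  exact hanti ⟨hu.1.le, by linarith [hu.2]⟩ (by norm_num) (by linarith [hu.2])

theorem sub_symm_difference_anti (hsym : ∀ x ∈ Set.Icc (0 : ℝ) 1, v x = -v (1 - x))
    (hconv : ConvexOn ℝ (Set.Icc 0 (1 / 2)) v) {s x y : ℝ} (hs : 0 ≤ s) (hsx : s ≤ x)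
    (hxy : x ≤ y) (hy : y ≤ 1 / 2) : v (y - s) - v (y + s) ≤ v (x - s) - v (x + s) := by
  have left : ∀ {x y : ℝ}, s ≤ x → x ≤ y → y + s ≤ 1 / 2 →
      v (y - s) - v (y + s) ≤ v (x - s) - v (x + s) := by
    intro x y hsx hxy hy
    have := hconv.map_add_map_le_of_add_eq (a := x - s) (b := y - s) (c := x + s) (d := y + s)
      ⟨by linarith, by linarith⟩ ⟨by linarith, by linarith⟩ (by linarith) (by linarith) (by ring)
    linarith
  have right : ∀ {x y : ℝ}, s ≤ x → x ≤ y → y ≤ 1 / 2 → 1 / 2 ≤ x + s →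
      v (y - s) - v (y + s) ≤ v (x - s) - v (x + s) := by
    intro x y hsx hxy hy hx
    have := hconv.map_add_map_le_of_add_eq (a := x - s) (b := y - s) (c := 1 - (y + s))
      (d := 1 - (x + s)) ⟨by linarith, by linarith⟩ ⟨by linarith, by linarith⟩
      (by linarith) (by linarith) (by ring)
    rw [hsym (x + s) ⟨by linarith, by linarith⟩, hsym (y + s) ⟨by linarith, by linarith⟩]
    linarith
  rcases le_total (1 / 2) (x + s) with h | h
  · exact right hsx hxy hy h
  rcases le_total (y + s) (1 / 2) with h' | h'
  · exact left hsx hxy h'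
  · exact (right (x := 1 / 2 - s) (by linarith) (by linarith) hy (by linarith)).trans
      (left hsx (by linarith) (by linarith))

theorem sub_symm_difference_nonneg (hhalf : v (1 / 2) = 0)
    (hsym : ∀ x ∈ Set.Icc (0 : ℝ) 1, v x = -v (1 - x))
    (hanti : StrictAntiOn v (Set.Icc 0 (1 / 2)))
    (hconv : ConvexOn ℝ (Set.Icc 0 (1 / 2)) v) {s x : ℝ} (hs : 0 ≤ s) (hsx : s ≤ x)
    (hx : x ≤ 1 / 2) : 0 ≤ v (x - s) - v (x + s) := by
  have h := sub_symm_difference_anti hsym hconv hs hsx hx le_rfl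
  have h2 := hsym (1 / 2 + s) ⟨by linarith, by linarith⟩
  rw [show (1 : ℝ) - (1 / 2 + s) = 1 / 2 - s by ring] at h2
  have h3 := nonneg_of_mem_left_half hhalf hanti (x := 1 / 2 - s) ⟨by linarith, by linarith⟩
  linarith

/-- On the left half, the averaged translate of `w` relative to `w` increases. -/
theorem wInt_ratio_mono (hcont : ContinuousOn v (Set.Icc 0 1)) (hhalf : v (1 / 2) = 0)
    (hsym : ∀ x ∈ Set.Icc (0 : ℝ) 1, v x = -v (1 - x))
    (hanti : StrictAntiOn v (Set.Icc 0 (1 / 2)))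
    (hconv : ConvexOn ℝ (Set.Icc 0 (1 / 2)) v) {h x y : ℝ} (hh : 0 < h) (hhx : h ≤ x)
    (hxy : x ≤ y) (hy : y ≤ 1 / 2) :
    (wInt v (x - h) + wInt v (x + h)) / (2 * wInt v x) ≤
      (wInt v (y - h) + wInt v (y + h)) / (2 * wInt v y) := by
  have integrable : ∀ z, h ≤ z → z ≤ 1 / 2 →
      IntervalIntegrable (fun s => v (z - s) - v (z + s)) MeasureTheory.volume 0 h := by
    intro z hz hz'
    refine ContinuousOn.intervalIntegrable ?_
    rw [Set.uIcc_of_le hh.le]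
    exact (hcont.comp (by fun_prop) fun s hs => ⟨by linarith [hs.2], by linarith [hs.1]⟩).sub
      (hcont.comp (by fun_prop) fun s hs => ⟨by linarith [hs.1], by linarith [hs.2]⟩)
  have hanti_int : ∫ s in (0 : ℝ)..h, (v (y - s) - v (y + s)) ≤
      ∫ s in (0 : ℝ)..h, (v (x - s) - v (x + s)) :=
    intervalIntegral.integral_mono_on hh.le (integrable y (hhx.trans hxy) hy)
      (integrable x hhx (hxy.trans hy)) fun s hs =>
        sub_symm_difference_anti hsym hconv hs.1 (hs.2.trans hhx) hxy hy
  have hnonneg : 0 ≤ ∫ s in (0 : ℝ)..h, (v (y - s) - v (y + s)) :=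
    intervalIntegral.integral_nonneg hh.le fun s hs =>
      sub_symm_difference_nonneg hhalf hsym hanti hconv hs.1 (by linarith [hs.2]) hy
  rw [← two_mul_wInt_sub hcont hh.le (by linarith) (by linarith)] at hanti_int hnonneg
  rw [← two_mul_wInt_sub hcont hh.le (by linarith) (by linarith)] at hanti_int
  have hwx := wInt_pos_left_half hcont hhalf hanti (hh.trans_le hhx) (hxy.trans hy)
  have hmono := wInt_mono_left_half hcont hhalf hanti (hh.le.trans hhx) hxy hy
  have hwy := hwx.trans_le hmono
  rw [div_le_div_iff₀ (by linarith) (by linarith)]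
  nlinarith [mul_le_mul_of_nonneg_left hmono hnonneg, mul_le_mul_of_nonneg_right hanti_int hwy.le]

theorem colRatio_eq (v : ℝ → ℝ) (K l : ℕ) :
    colRatio v K l = (wInt v ((l : ℝ) / K - 1 / K) + wInt v ((l : ℝ) / K + 1 / K)) /
      (2 * wInt v ((l : ℝ) / K)) := by
  rw [← sub_div, ← add_div, colRatio]

theorem colRatio_reflect (hcont : ContinuousOn v (Set.Icc 0 1))
    (hsym : ∀ x ∈ Set.Icc (0 : ℝ) 1, v x = -v (1 - x)) {K l : ℕ} (hl : 1 ≤ l) (hlK : l + 1 ≤ K) :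
    colRatio v K (K - l) = colRatio v K l := by
  have hK : (0 : ℝ) < K := by exact_mod_cast (show 0 < K by omega)
  have hl' : (1 : ℝ) ≤ l := by exact_mod_cast hl
  have hlK' : (l : ℝ) + 1 ≤ K := by exact_mod_cast hlK
  have mem : ∀ a : ℝ, 0 ≤ a → a ≤ K → a / K ∈ Set.Icc (0 : ℝ) 1 := fun a h0 h1 =>
    ⟨by positivity, (div_le_one hK).2 h1⟩
  unfold colRatio
  rw [Nat.cast_sub (by omega),
    show ((K : ℝ) - l - 1) / K = 1 - (l + 1) / K by field_simp; ring,
    show ((K : ℝ) - l + 1) / K = 1 - (l - 1) / K by field_simp; ring,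
    show ((K : ℝ) - l) / K = 1 - l / K by field_simp,
    wInt_one_sub hcont hsym (mem _ (by linarith) hlK'),
    wInt_one_sub hcont hsym (mem _ (by linarith) (by linarith)),
    wInt_one_sub hcont hsym (mem _ (by linarith) (by linarith)), add_comm]

theorem colRatio_le_half (hcont : ContinuousOn v (Set.Icc 0 1)) (hhalf : v (1 / 2) = 0)
    (hsym : ∀ x ∈ Set.Icc (0 : ℝ) 1, v x = -v (1 - x))
    (hanti : StrictAntiOn v (Set.Icc 0 (1 / 2)))
    (hconv : ConvexOn ℝ (Set.Icc 0 (1 / 2)) v) {K l : ℕ} (hl : 1 ≤ l) (hlK : l + 1 ≤ K) :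
    colRatio v K l ≤ colRatio v K (K / 2) := by
  have left : ∀ m : ℕ, 1 ≤ m → m ≤ K / 2 → colRatio v K m ≤ colRatio v K (K / 2) := by
    intro m hm hmK
    have hK : (0 : ℝ) < K := by exact_mod_cast (show 0 < K by omega)
    have hm' : (1 : ℝ) ≤ m := by exact_mod_cast hm
    have hmK' : (m : ℝ) ≤ (K / 2 : ℕ) := by exact_mod_cast hmK
    have hK2 : ((K / 2 : ℕ) : ℝ) ≤ K / 2 := Nat.cast_div_le
    rw [colRatio_eq, colRatio_eq]
    refine wInt_ratio_mono hcont hhalf hsym hanti hconv (one_div_pos.2 hK) (div_le_div_of_nonneg_right hm' hK.le)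
      (div_le_div_of_nonneg_right hmK' hK.le) ?_
    rw [div_le_iff₀ hK]
    linarith
  rcases le_or_gt l (K / 2) with h | h
  · exact left l hl h
  · rw [← colRatio_reflect hcont hsym hl hlK]
    exact left _ (by omega) (by omega)

theorem wInt_ratio_half (hcont : ContinuousOn v (Set.Icc 0 1)) (hhalf : v (1 / 2) = 0)
    (hsym : ∀ x ∈ Set.Icc (0 : ℝ) 1, v x = -v (1 - x))
    (hanti : StrictAntiOn v (Set.Icc 0 (1 / 2))) {h : ℝ} (hh : 0 ≤ h) (hh' : h ≤ 1 / 2) :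
    (wInt v (1 / 2 - h) + wInt v (1 / 2 + h)) / (2 * wInt v (1 / 2)) =
      1 - (∫ y in (1 / 2 - h)..(1 / 2), v y) / ∫ y in (0 : ℝ)..(1 / 2), v y := by
  have hmem : 1 / 2 - h ∈ Set.Icc (0 : ℝ) 1 := ⟨by linarith, by linarith⟩
  have hpos := wInt_pos_left_half hcont hhalf hanti one_half_pos le_rfl
  have hrefl := wInt_one_sub hcont hsym hmem
  rw [show (1 : ℝ) - (1 / 2 - h) = 1 / 2 + h by ring] at hrefl
  change _ = 1 - _ / wInt v (1 / 2)
  rw [hrefl, ← wInt_sub hcont hmem (by norm_num)]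
  field_simp
  ring

theorem wInt_ratio_near_half_le (hcont : ContinuousOn v (Set.Icc 0 1)) (hhalf : v (1 / 2) = 0)
    (hsym : ∀ x ∈ Set.Icc (0 : ℝ) 1, v x = -v (1 - x))
    (hanti : StrictAntiOn v (Set.Icc 0 (1 / 2))) {h : ℝ} (hh : 0 < h) (hh' : 3 * h ≤ 1) :
    (wInt v (1 / 2 - h / 2 - h) + wInt v (1 / 2 - h / 2 + h)) / (2 * wInt v (1 / 2 - h / 2)) ≤
      1 - (∫ y in (1 / 2 - h)..(1 / 2), v y) / (2 * ∫ y in (0 : ℝ)..(1 / 2), v y) := by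
  have hpos := wInt_pos_left_half hcont hhalf hanti (x := 1 / 2 - h / 2) (by linarith)
    (by linarith)
  have hmono := wInt_mono_left_half hcont hhalf hanti (x := 1 / 2 - h / 2) (y := 1 / 2)
    (by linarith) (by linarith) le_rfl
  have hrefl := wInt_one_sub hcont hsym (x := 1 / 2 - h / 2) ⟨by linarith, by linarith⟩
  rw [show (1 : ℝ) - (1 / 2 - h / 2) = 1 / 2 - h / 2 + h by ring] at hrefl
  have hshift : ∫ y in (1 / 2 - h)..(1 / 2), v y ≤
      ∫ y in (1 / 2 - h / 2 - h)..(1 / 2 - h / 2), v y := by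
    have htrans : ∫ y in (1 / 2 - h)..(1 / 2), v (y - h / 2) =
        ∫ y in (1 / 2 - h / 2 - h)..(1 / 2 - h / 2), v y := by
      rw [intervalIntegral.integral_comp_sub_right, sub_right_comm]
    rw [← htrans]
    refine intervalIntegral.integral_mono_on (by linarith)
      (hcont.intervalIntegrable_of_mem_unitInterval ⟨by linarith, by linarith⟩ (by norm_num))
      (ContinuousOn.intervalIntegrable ?_) fun y hy =>
        hanti.antitoneOn ⟨by linarith [hy.1], by linarith [hy.2]⟩
          ⟨by linarith [hy.1], by linarith [hy.2]⟩ (by linarith)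
    rw [Set.uIcc_of_le (by linarith)]
    exact hcont.comp (by fun_prop) fun y hy => ⟨by linarith [hy.1], by linarith [hy.2]⟩
  have hnonneg : 0 ≤ ∫ y in (1 / 2 - h)..(1 / 2), v y :=
    intervalIntegral.integral_nonneg (by linarith) fun u hu =>
      nonneg_of_mem_left_half hhalf hanti ⟨by linarith [hu.1], hu.2⟩
  rw [← wInt_sub hcont (a := 1 / 2 - h / 2 - h) ⟨by linarith, by linarith⟩
    ⟨by linarith, by linarith⟩] at hshift
  have hcompare : (∫ y in (1 / 2 - h)..(1 / 2), v y) / (2 * wInt v (1 / 2)) ≤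
      (wInt v (1 / 2 - h / 2) - wInt v (1 / 2 - h / 2 - h)) / (2 * wInt v (1 / 2 - h / 2)) :=
    div_le_div₀ (hnonneg.trans hshift) hshift (by linarith) (by linarith)
  have hratio : (wInt v (1 / 2 - h / 2 - h) + wInt v (1 / 2 - h / 2 + h)) /
      (2 * wInt v (1 / 2 - h / 2)) =
      1 - (wInt v (1 / 2 - h / 2) - wInt v (1 / 2 - h / 2 - h)) /
        (2 * wInt v (1 / 2 - h / 2)) := by
    rw [hrefl, eq_sub_iff_add_eq, ← add_div, div_eq_one_iff_eq (by linarith)]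
    ring
  rw [hratio]
  exact sub_le_sub_left hcompare 1

end Antisymmetric

theorem abs_half_div_sub_le {K : ℕ} (hK : 0 < K) (l : ℕ) :
    |((K / 2 : ℕ) : ℝ) / K - 1 / 2| ≤ |(l : ℝ) / K - 1 / 2| := by
  have hK' : (0 : ℝ) < K := by exact_mod_cast hK
  have key : ∀ m : ℕ, |(m : ℝ) / K - 1 / 2| = |((2 * m - K : ℤ) : ℝ)| / (2 * K) := by
    intro m
    rw [show (m : ℝ) / K - 1 / 2 = ((2 * m - K : ℤ) : ℝ) / (2 * K) by push_cast; field_simp,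
      abs_div, abs_of_pos (show (0 : ℝ) < 2 * K by positivity)]
  rw [key, key]
  gcongr ?_ / _
  have : |(2 * (K / 2 : ℕ) - K : ℤ)| ≤ |(2 * l - K : ℤ)| := by
    rcases abs_cases (2 * (K / 2 : ℕ) - K : ℤ) with h | h <;>
      rcases abs_cases (2 * l - K : ℤ) with h' | h' <;> omega
  exact_mod_cast this

/-- the maximum of `(w((l−1)/K)+w((l+1)/K))/(2w(l/K))` over
`l = 1,…,K−1` is attained at an index with `l/K` closest to `1/2`; its value is
computed for even `K` and estimated for odd `K`. -/
theorem max_colRatio_attained_near_half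
    (K : ℕ) (hK : 4 ≤ K) (v : ℝ → ℝ)
    (hcont : ContinuousOn v (Set.Icc 0 1))
    (hhalf : v (1 / 2) = 0)
    (hsym : ∀ x ∈ Set.Icc (0 : ℝ) 1, v x = -v (1 - x))
    (hanti : StrictAntiOn v (Set.Icc 0 (1 / 2)))
    (hconv : ConvexOn ℝ (Set.Icc 0 (1 / 2)) v) :
    ∃ l0 ∈ Finset.Icc 1 (K - 1),
      (∀ l ∈ Finset.Icc 1 (K - 1), colRatio v K l ≤ colRatio v K l0) ∧
      (∀ l ∈ Finset.Icc 1 (K - 1),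
        |(l0 : ℝ) / K - 1 / 2| ≤ |(l : ℝ) / K - 1 / 2|) ∧
      (Even K → colRatio v K l0 =
        1 - (∫ y in (1 / 2 - 1 / (K : ℝ))..(1 / 2), v y) /
          (∫ y in (0 : ℝ)..(1 / 2), v y)) ∧
      (Odd K → l0 = (K - 1) / 2 ∧ colRatio v K l0 ≤
        1 - (∫ y in (((K : ℝ) - 2) / (2 * K))..(1 / 2), v y) /
          (2 * ∫ y in (0 : ℝ)..(1 / 2), v y)) := by
  have hK0 : (0 : ℝ) < K := by exact_mod_cast (show 0 < K by omega)
  have hK4 : (4 : ℝ) ≤ K := by exact_mod_cast hK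
  refine ⟨K / 2, Finset.mem_Icc.2 ⟨by omega, by omega⟩, fun l hl => ?_,
    fun l _ => abs_half_div_sub_le (by omega) l, fun heven => ?_, fun hodd => ?_⟩
  · obtain ⟨h1, h2⟩ := Finset.mem_Icc.1 hl
    exact colRatio_le_half hcont hhalf hsym hanti hconv h1 (by omega)
  · have hx : ((K / 2 : ℕ) : ℝ) / K = 1 / 2 := by
      rw [Nat.cast_div heven.two_dvd (by norm_num)]
      push_cast
      field_simp
    rw [colRatio_eq, hx]
    refine wInt_ratio_half hcont hhalf hsym hanti (one_div_pos.2 hK0).le ?_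
    rw [div_le_iff₀ hK0]
    linarith
  · have hx : ((K / 2 : ℕ) : ℝ) / K = 1 / 2 - 1 / K / 2 := by
      obtain ⟨m, rfl⟩ := hodd
      rw [show (2 * m + 1) / 2 = m by omega]
      push_cast at hK0 ⊢
      field_simp
      ring
    refine ⟨by obtain ⟨m, rfl⟩ := hodd; omega, ?_⟩
    rw [colRatio_eq, hx, show ((K : ℝ) - 2) / (2 * K) = 1 / 2 - 1 / K by field_simp]
    refine wInt_ratio_near_half_le hcont hhalf hsym hanti (one_div_pos.2 hK0) ?_
    rw [mul_one_div, div_le_one hK0]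
    linarith
end

section
/- Let K ≥ 4 be an integer and let v : [0,1] → ℝ be continuous with v(1/2) = 0, v(x) = −v(1−x) for all x ∈ [0,1], and v strictly decreasing and convex on [0,1/2]. Set w(x) = ∫_0^x v(y) dy. Then (max_{l=1,…,K−1} w(l/K)) / (min_{l=1,…,K−1} w(l/K)) multiplied by (1 − max_{l=1,…,K−1} (w((l−1)/K) + w((l+1)/K))/(2 w(l/K)))^{−1} is at most 2 (∫_0^{1/2} v(y) dy)² / ((∫_{1/2−1/K}^{1/2} v(y) dy) · (∫_0^{1/K} v(y) dy)). -/
open scoped BigOperators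

open MeasureTheory intervalIntegral Set

/-- A continuous function on `[0, 1]` that is odd about `1 / 2`, and strictly decreasing and convex
on `[0, 1 / 2]`. -/
structure IsDriftProfile (v : ℝ → ℝ) : Prop where
  continuousOn : ContinuousOn v (Icc 0 1)
  half : v (1 / 2) = 0
  symm : ∀ x ∈ Icc (0 : ℝ) 1, v x = -v (1 - x)
  anti : StrictAntiOn v (Icc 0 (1 / 2))
  convex : ConvexOn ℝ (Icc 0 (1 / 2)) v

/-- For a convex function, moving two points apart symmetrically increases the sum of values. -/
theorem ConvexOn.add_le_add_of_add_eq {S : Set ℝ} {f : ℝ → ℝ} (hf : ConvexOn ℝ S f)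
    {a b c d : ℝ} (ha : a ∈ S) (hd : d ∈ S) (hab : a ≤ b) (hbd : b ≤ d) (hsum : b + c = a + d) :
    f b + f c ≤ f a + f d := by
  rcases (hab.trans hbd).eq_or_lt with rfl | had
  · obtain rfl : b = a := le_antisymm hbd hab
    obtain rfl : c = b := by linarith
    rfl
  · have hne : d - a ≠ 0 := by linarith
    have hpos : 0 < d - a := by linarith
    have hp : 0 ≤ (d - b) / (d - a) := div_nonneg (by linarith) hpos.le
    have hq : 0 ≤ (b - a) / (d - a) := div_nonneg (by linarith) hpos.le
    have hpq : (d - b) / (d - a) + (b - a) / (d - a) = 1 := by field_simp; ring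
    have h₁ := hf.2 ha hd hp hq hpq
    have h₂ := hf.2 ha hd hq hp (by linarith)
    have e₁ : (d - b) / (d - a) * a + (b - a) / (d - a) * d = b := by field_simp; ring
    have e₂ : (b - a) / (d - a) * a + (d - b) / (d - a) * d = c := by
      obtain rfl : c = a + d - b := by linarith
      field_simp; ring
    simp only [smul_eq_mul, e₁, e₂] at h₁ h₂
    have e₃ : f a + f d = ((d - b) / (d - a) + (b - a) / (d - a)) * (f a + f d) := by
      rw [hpq, one_mul]
    rw [e₃]
    linarith

namespace IsDriftProfile

variable {v : ℝ → ℝ} (hv : IsDriftProfile v)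

include hv

theorem pos {x : ℝ} (h₀ : 0 ≤ x) (h₁ : x < 1 / 2) : 0 < v x := by
  rw [← hv.half]
  exact hv.anti ⟨h₀, h₁.le⟩ ⟨by norm_num, le_rfl⟩ h₁

theorem nonneg {x : ℝ} (h₀ : 0 ≤ x) (h₁ : x ≤ 1 / 2) : 0 ≤ v x := by
  rw [← hv.half]
  exact hv.anti.antitoneOn ⟨h₀, h₁⟩ ⟨by norm_num, le_rfl⟩ h₁

theorem nonpos {x : ℝ} (h₀ : 1 / 2 ≤ x) (h₁ : x ≤ 1) : v x ≤ 0 := by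
  rw [hv.symm x ⟨by linarith, h₁⟩]
  have := hv.nonneg (x := 1 - x) (by linarith) (by linarith)
  linarith

theorem le_sub_of_le_half {x s : ℝ} (hs : 0 ≤ s) (hsx : s ≤ x) (hx : x ≤ 1 / 2) :
    v (1 / 2 - s) ≤ v (x - s) - v (x + s) := by
  rcases le_or_gt (x + s) (1 / 2) with h | h
  · have h₁ := hv.convex.add_le_add_of_add_eq (a := x - s) (b := x) (c := 1 / 2 - s) (d := 1 / 2)
      ⟨by linarith, by linarith⟩ ⟨by norm_num, le_rfl⟩ (by linarith) hx (by ring)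
    have h₂ : v (x + s) ≤ v x :=
      hv.anti.antitoneOn ⟨by linarith, hx⟩ ⟨by linarith, h⟩ (by linarith)
    rw [hv.half] at h₁
    linarith
  · have h₁ : v (1 / 2 - s) ≤ v (x - s) :=
      hv.anti.antitoneOn ⟨by linarith, by linarith⟩ ⟨by linarith, by linarith⟩ (by linarith)
    have h₂ := hv.nonpos (x := x + s) h.le (by linarith)
    linarith

theorem le_sub {x s : ℝ} (hs : 0 ≤ s) (hsx : s ≤ x) (hx : x + s ≤ 1) :
    v (1 / 2 - s) ≤ v (x - s) - v (x + s) := by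
  rcases le_total x (1 / 2) with h | h
  · exact hv.le_sub_of_le_half hs hsx h
  · have := hv.le_sub_of_le_half (x := 1 - x) hs (by linarith) (by linarith)
    rw [hv.symm (x - s) ⟨by linarith, by linarith⟩, hv.symm (x + s) ⟨by linarith, hx⟩,
      show 1 - (x - s) = 1 - x + s by ring, show 1 - (x + s) = 1 - x - s by ring]
    linarith

theorem intervalIntegrable {a b : ℝ} (ha : a ∈ Icc (0 : ℝ) 1) (hb : b ∈ Icc (0 : ℝ) 1) :
    IntervalIntegrable v volume a b :=
  (hv.continuousOn.mono (ordConnected_Icc.uIcc_subset ha hb)).intervalIntegrable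

theorem wInt_sub {a b : ℝ} (ha : a ∈ Icc (0 : ℝ) 1) (hb : b ∈ Icc (0 : ℝ) 1) :
    wInt v b - wInt v a = ∫ y in a..b, v y :=
  integral_interval_sub_left (hv.intervalIntegrable ⟨le_rfl, zero_le_one⟩ hb)
    (hv.intervalIntegrable ⟨le_rfl, zero_le_one⟩ ha)

theorem wInt_mono {a b : ℝ} (ha : 0 ≤ a) (hab : a ≤ b) (hb : b ≤ 1 / 2) :
    wInt v a ≤ wInt v b := by
  rw [← sub_nonneg, hv.wInt_sub ⟨ha, by linarith⟩ ⟨by linarith, by linarith⟩]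
  exact integral_nonneg hab fun y hy => hv.nonneg (ha.trans hy.1) (hy.2.trans hb)

theorem wInt_one_sub {x : ℝ} (hx : x ∈ Icc (0 : ℝ) 1) : wInt v (1 - x) = wInt v x := by
  have hx' : 1 - x ∈ Icc (0 : ℝ) 1 := ⟨by linarith [hx.2], by linarith [hx.1]⟩
  have h₁ : ∫ y in x..(1 - x), v y = -∫ y in x..(1 - x), v (1 - y) := by
    rw [← intervalIntegral.integral_neg]
    exact integral_congr fun y hy => hv.symm y (ordConnected_Icc.uIcc_subset hx hx' hy)
  rw [integral_comp_sub_left (fun y => v y), sub_sub_cancel] at h₁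
  have h₂ := hv.wInt_sub hx hx'
  linarith

theorem wInt_le_half {x : ℝ} (hx : x ∈ Icc (0 : ℝ) 1) : wInt v x ≤ wInt v (1 / 2) := by
  rcases le_total x (1 / 2) with h | h
  · exact hv.wInt_mono hx.1 h le_rfl
  · rw [← hv.wInt_one_sub hx]
    exact hv.wInt_mono (by linarith [hx.2]) (by linarith) le_rfl

theorem wInt_le {h x : ℝ} (h₀ : 0 ≤ h) (h₁ : h ≤ x) (h₂ : x + h ≤ 1) : wInt v h ≤ wInt v x := by
  rcases le_total x (1 / 2) with hx | hx
  · exact hv.wInt_mono h₀ h₁ hx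
  · rw [← hv.wInt_one_sub (x := x) ⟨by linarith, by linarith⟩]
    exact hv.wInt_mono h₀ (by linarith) (by linarith)

theorem integral_pos {a b : ℝ} (ha : 0 ≤ a) (hab : a < b) (hb : b ≤ 1 / 2) :
    0 < ∫ y in a..b, v y :=
  intervalIntegral_pos_of_pos_on
    (hv.intervalIntegrable ⟨ha, by linarith⟩ ⟨by linarith, by linarith⟩)
    (fun _ hy => hv.pos (ha.trans hy.1.le) (hy.2.trans_le hb)) hab

theorem integral_le_second_difference {h x : ℝ} (h₀ : 0 ≤ h) (h₁ : h ≤ x) (h₂ : x + h ≤ 1) :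
    ∫ y in (1 / 2 - h)..(1 / 2), v y ≤ 2 * wInt v x - wInt v (x - h) - wInt v (x + h) := by
  have hcont : ∀ f : ℝ → ℝ, Continuous f → (∀ s ∈ Icc 0 h, f s ∈ Icc (0 : ℝ) 1) →
      IntervalIntegrable (fun s => v (f s)) volume 0 h := fun f hf hmaps =>
    (hv.continuousOn.comp hf.continuousOn (by rwa [uIcc_of_le h₀])).intervalIntegrable
  have i₁ := hcont (fun s => x - s) (by fun_prop)
    fun s hs => ⟨by linarith [hs.2], by linarith [hs.1]⟩
  have i₂ := hcont (fun s => x + s) (by fun_prop)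
    fun s hs => ⟨by linarith [hs.1], by linarith [hs.2]⟩
  have i₃ := hcont (fun s => 1 / 2 - s) (by fun_prop)
    fun s hs => ⟨by linarith [hs.2], by linarith [hs.1]⟩
  have key := integral_mono_on h₀ i₃ (i₁.sub i₂)
    fun s hs => hv.le_sub hs.1 (hs.2.trans h₁) (by linarith [hs.2])
  rw [integral_sub i₁ i₂, integral_comp_sub_left (fun y => v y),
    integral_comp_sub_left (fun y => v y), integral_comp_add_left (fun y => v y), sub_zero,
    sub_zero, add_zero,
    ← hv.wInt_sub (a := x - h) (b := x) ⟨by linarith, by linarith⟩ ⟨by linarith, by linarith⟩,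
    ← hv.wInt_sub (a := x) (b := x + h) ⟨by linarith, by linarith⟩ ⟨by linarith, h₂⟩] at key
  linarith

end IsDriftProfile

/-- the bound
`ρ / (1 − ‖R‖_cs) ≤ 2 (∫_0^{1/2} v)² / ((∫_{1/2−1/K}^{1/2} v) (∫_0^{1/K} v))`
where `ρ = max_l w(l/K) / min_l w(l/K)` and
`‖R‖_cs = max_l (w((l−1)/K)+w((l+1)/K))/(2w(l/K))`. -/
theorem ratio_over_one_sub_csNorm_bound
    (K : ℕ) (hK : 4 ≤ K) (v : ℝ → ℝ)
    (hcont : ContinuousOn v (Set.Icc 0 1))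
    (hhalf : v (1 / 2) = 0)
    (hsym : ∀ x ∈ Set.Icc (0 : ℝ) 1, v x = -v (1 - x))
    (hanti : StrictAntiOn v (Set.Icc 0 (1 / 2)))
    (hconv : ConvexOn ℝ (Set.Icc 0 (1 / 2)) v) :
    ((Finset.Icc 1 (K - 1)).sup' (Finset.nonempty_Icc.mpr (by omega))
        (fun l => wInt v ((l : ℝ) / K)) /
      (Finset.Icc 1 (K - 1)).inf' (Finset.nonempty_Icc.mpr (by omega))
        (fun l => wInt v ((l : ℝ) / K))) *
      (1 - (Finset.Icc 1 (K - 1)).sup' (Finset.nonempty_Icc.mpr (by omega))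
        (fun l => colRatio v K l))⁻¹ ≤
    2 * (∫ y in (0 : ℝ)..(1 / 2), v y) ^ 2 /
      ((∫ y in (1 / 2 - 1 / (K : ℝ))..(1 / 2), v y) *
        (∫ y in (0 : ℝ)..(1 / (K : ℝ)), v y)) := by
  have hv : IsDriftProfile v := ⟨hcont, hhalf, hsym, hanti, hconv⟩
  have hK' : (4 : ℝ) ≤ K := by exact_mod_cast hK
  have hK₀ : (0 : ℝ) < K := by linarith
  have hh : 0 < 1 / (K : ℝ) := by positivity
  have hh' : 1 / (K : ℝ) ≤ 1 / 4 := one_div_le_one_div_of_le (by norm_num) hK'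
  have hA := hv.integral_pos (a := 1 / 2 - 1 / (K : ℝ)) (by linarith) (by linarith) le_rfl
  have hw : 0 < wInt v (1 / K) := hv.integral_pos le_rfl hh (by linarith)
  have hW : 0 < wInt v (1 / 2) := hv.integral_pos le_rfl (by norm_num) le_rfl
  have hgrid : ∀ l ∈ Finset.Icc 1 (K - 1), 1 / (K : ℝ) ≤ l / K ∧ (l : ℝ) / K + 1 / K ≤ 1 := by
    intro l hl
    rw [Finset.mem_Icc] at hl
    have h₁ : (1 : ℝ) ≤ l := by exact_mod_cast hl.1
    have h₂ : (l : ℝ) + 1 ≤ K := by exact_mod_cast (by omega : l + 1 ≤ K)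
    refine ⟨by gcongr, ?_⟩
    rw [← add_div]
    exact (div_le_one hK₀).mpr h₂
  change _ ≤ 2 * wInt v (1 / 2) ^ 2 / ((∫ y in (1 / 2 - 1 / (K : ℝ))..(1 / 2), v y) *
    wInt v (1 / K))
  generalize hA_def : (∫ y in (1 / 2 - 1 / (K : ℝ))..(1 / 2), v y) = A at *
  have hmax : (Finset.Icc 1 (K - 1)).sup' (Finset.nonempty_Icc.mpr (by omega))
      (fun l => wInt v ((l : ℝ) / K)) ≤ wInt v (1 / 2) :=
    Finset.sup'_le _ _ fun l hl => by
      obtain ⟨h₁, h₂⟩ := hgrid l hl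
      exact hv.wInt_le_half ⟨by linarith, by linarith⟩
  have hmin : wInt v (1 / K) ≤ (Finset.Icc 1 (K - 1)).inf' (Finset.nonempty_Icc.mpr (by omega))
      (fun l => wInt v ((l : ℝ) / K)) :=
    Finset.le_inf' _ _ fun l hl => hv.wInt_le hh.le (hgrid l hl).1 (hgrid l hl).2
  have hcol : (Finset.Icc 1 (K - 1)).sup' (Finset.nonempty_Icc.mpr (by omega))
      (fun l => colRatio v K l) ≤ 1 - A / (2 * wInt v (1 / 2)) :=
    Finset.sup'_le _ _ fun l hl => by
      obtain ⟨h₁, h₂⟩ := hgrid l hl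
      have hD := hv.integral_le_second_difference hh.le h₁ h₂
      have hwl : 0 < wInt v ((l : ℝ) / K) := hw.trans_le (hv.wInt_le hh.le h₁ h₂)
      have hle : A / (2 * wInt v (1 / 2)) ≤ A / (2 * wInt v ((l : ℝ) / K)) := by
        have := hv.wInt_le_half (x := (l : ℝ) / K) ⟨by linarith, by linarith⟩
        gcongr
      have hc : colRatio v K l ≤ 1 - A / (2 * wInt v ((l : ℝ) / K)) := by
        rw [colRatio, sub_div (l : ℝ), add_div (l : ℝ), one_sub_div (by positivity)]
        gcongr
        linarith
      linarith
  have hinv : (1 - (Finset.Icc 1 (K - 1)).sup' (Finset.nonempty_Icc.mpr (by omega))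
      (fun l => colRatio v K l))⁻¹ ≤ (A / (2 * wInt v (1 / 2)))⁻¹ :=
    inv_anti₀ (by positivity) (by linarith)
  have hpos : 0 < A / (2 * wInt v (1 / 2)) := by positivity
  refine (mul_le_mul (div_le_div₀ hW.le hmax hw hmin) hinv
    (inv_nonneg.mpr (by linarith)) (by positivity)).trans_eq ?_
  field_simp
end

section
/- Let ε ∈ (0,1/4] and let v : [0,1/2] → ℝ be nonnegative and convex with v(1/2) = 0. Then ∫_{1/2−ε}^{1/2} v(y) dy ≤ 4ε² · ∫_0^{1/2} v(y) dy. -/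
/-- A convex function on `[a, b]` that vanishes at `b` is contracted by homotheties centred
at `b`. -/
theorem ConvexOn.map_homothety_le {a b : ℝ} {v : ℝ → ℝ} (hv : ConvexOn ℝ (Set.Icc a b) v)
    (hb : v b = 0) {c x : ℝ} (hc0 : 0 ≤ c) (hc1 : c ≤ 1) (hx : x ∈ Set.Icc a b) :
    v (c * x + (1 - c) * b) ≤ c * v x := by
  have h := hv.2 hx (Set.right_mem_Icc.2 (hx.1.trans hx.2)) hc0 (sub_nonneg.2 hc1)
    (add_sub_cancel c 1)
  simpa [hb] using h

/-- A nonnegative convex function on `[a, b]` that vanishes at `b` is antitone. -/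
theorem ConvexOn.antitoneOn_of_nonneg_of_right_eq_zero {a b : ℝ} {v : ℝ → ℝ}
    (hv : ConvexOn ℝ (Set.Icc a b) v) (hnn : ∀ x ∈ Set.Icc a b, 0 ≤ v x) (hb : v b = 0) :
    AntitoneOn v (Set.Icc a b) := by
  intro x hx y hy hxy
  rcases hx.2.eq_or_lt with rfl | hlt
  · rw [le_antisymm hy.2 hxy]
  have hpos : 0 < b - x := sub_pos.2 hlt
  have hc0 : 0 ≤ (b - y) / (b - x) := div_nonneg (sub_nonneg.2 hy.2) hpos.le
  have hc1 : (b - y) / (b - x) ≤ 1 := (div_le_one hpos).2 (by linarith)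
  have h := hv.map_homothety_le hb hc0 hc1 hx
  have e : (b - y) / (b - x) * x + (1 - (b - y) / (b - x)) * b = y := by
    field_simp
    ring
  rw [e] at h
  exact h.trans (mul_le_of_le_one_left (hnn x hx) hc1)

/-- for a nonnegative convex function `v` on `[0,1/2]` vanishing at
`1/2`, and `ε ∈ (0,1/4]`, one has `∫_{1/2−ε}^{1/2} v ≤ 4ε² ∫_0^{1/2} v`. -/
theorem tail_integral_bound_of_convex
    (ε : ℝ) (hε0 : 0 < ε) (hε : ε ≤ 1 / 4) (v : ℝ → ℝ)
    (hnn : ∀ x ∈ Set.Icc (0 : ℝ) (1 / 2), 0 ≤ v x)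
    (hconv : ConvexOn ℝ (Set.Icc 0 (1 / 2)) v)
    (hvhalf : v (1 / 2) = 0) :
    (∫ y in (1 / 2 - ε)..(1 / 2), v y) ≤ 4 * ε ^ 2 * ∫ y in (0 : ℝ)..(1 / 2), v y := by
  have hanti := hconv.antitoneOn_of_nonneg_of_right_eq_zero hnn hvhalf
  have hIcc : Set.uIcc (0 : ℝ) (1 / 2) = Set.Icc 0 (1 / 2) := Set.uIcc_of_le (by norm_num)
  have hint : IntervalIntegrable v MeasureTheory.volume 0 (1 / 2) :=
    AntitoneOn.intervalIntegrable (hIcc ▸ hanti)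
  have hint' : IntervalIntegrable (fun x => v (2 * ε * x + (1 - 2 * ε) * (1 / 2)))
      MeasureTheory.volume 0 (1 / 2) := by
    apply AntitoneOn.intervalIntegrable
    rw [hIcc]
    intro x hx y hy hxy
    obtain ⟨hx0, hx1⟩ := hx
    obtain ⟨hy0, hy1⟩ := hy
    exact hanti ⟨by nlinarith, by nlinarith⟩ ⟨by nlinarith, by nlinarith⟩ (by nlinarith)
  have hsub := intervalIntegral.mul_integral_comp_mul_add (f := v) (a := 0) (b := 1 / 2) (2 * ε)
    ((1 - 2 * ε) * (1 / 2))
  rw [show 2 * ε * 0 + (1 - 2 * ε) * (1 / 2) = 1 / 2 - ε by ring,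
    show 2 * ε * (1 / 2) + (1 - 2 * ε) * (1 / 2) = 1 / 2 by ring] at hsub
  have hmono := intervalIntegral.integral_mono_on (by norm_num) hint' (hint.const_mul (2 * ε))
    fun x hx => hconv.map_homothety_le hvhalf (by linarith) (by linarith) hx
  rw [intervalIntegral.integral_const_mul] at hmono
  calc (∫ y in (1 / 2 - ε)..(1 / 2), v y)
      = 2 * ε * ∫ x in (0 : ℝ)..(1 / 2), v (2 * ε * x + (1 - 2 * ε) * (1 / 2)) := hsub.symm
    _ ≤ 2 * ε * (2 * ε * ∫ y in (0 : ℝ)..(1 / 2), v y) := by gcongr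
    _ = 4 * ε ^ 2 * ∫ y in (0 : ℝ)..(1 / 2), v y := by ring
end

section
/- Let K ≥ 2 be an integer, T > 0, and let x, x̃ ∈ C([0,T],ℝ^{K−1}) satisfy x_j(0) ≥ 0 and x̃_j(0) ≥ 0 for all j. Suppose (y,z) is a solution of the Skorokhod problem for x with reflection matrix Q^{(K−1)} and (ỹ,z̃) is a solution of the Skorokhod problem for x̃ with reflection matrix Q^{(K−1)}. Then ‖y − ỹ‖_{T,2} ≤ 2(K−1)^{5/2} · ‖x − x̃‖_{T,2}. -/
open scoped BigOperators

/-- `(y,z)` solves the Skorokhod problem on `[0,T]` for the input path `x` with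
the tridiagonal reflection matrix `Q^{(K−1)}` (entries `1/2` off the diagonal).
Paths are indexed by `j = 1,…,K−1`, with the convention `y_0 ≡ 0`, `y_K ≡ 0`. -/
def IsSkorokhodSolution (K : ℕ) (T : ℝ) (x y z : ℝ → ℕ → ℝ) : Prop :=
  (∀ j ∈ Finset.Icc 1 (K - 1), ContinuousOn (fun t => y t j) (Set.Icc 0 T) ∧
      ContinuousOn (fun t => z t j) (Set.Icc 0 T)) ∧
  (∀ t : ℝ, y t 0 = 0) ∧ (∀ t : ℝ, y t K = 0) ∧
  (∀ t ∈ Set.Icc (0 : ℝ) T, ∀ j ∈ Finset.Icc 1 (K - 1),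
    z t j = x t j + y t j - (1 / 2) * y t (j - 1) - (1 / 2) * y t (j + 1)) ∧
  (∀ t ∈ Set.Icc (0 : ℝ) T, ∀ j ∈ Finset.Icc 1 (K - 1), 0 ≤ z t j) ∧
  (∀ j ∈ Finset.Icc 1 (K - 1),
    MonotoneOn (fun t => y t j) (Set.Icc 0 T) ∧ y 0 j = 0) ∧
  (∀ j ∈ Finset.Icc 1 (K - 1), ∀ a b : ℝ, 0 ≤ a → a ≤ b → b ≤ T →
    (∀ t ∈ Set.Icc a b, 0 < z t j) → ∀ t ∈ Set.Icc a b, y t j = y a j)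

/-- The `‖·‖_{T,2}` norm of a path indexed by `1,…,K−1`. -/
noncomputable def normT2 (T : ℝ) (K : ℕ) (f : ℝ → ℕ → ℝ) : ℝ :=
  Real.sqrt ((1 / ((K : ℝ) - 1)) *
    ∑ j ∈ Finset.Icc 1 (K - 1), ⨆ t : Set.Icc (0 : ℝ) T, (f t.1 j) ^ 2)

/-- Maximum principle for discretely convex sequences on `{0,…,K}`. -/
theorem discrete_maximum_principle {K : ℕ} {w : ℕ → ℝ} (h0 : w 0 ≤ 0) (hK : w K ≤ 0)
    (hw : ∀ j ∈ Finset.Icc 1 (K - 1), w j ≤ (1 / 2) * w (j - 1) + (1 / 2) * w (j + 1))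
    {j : ℕ} (hj : j ≤ K) : w j ≤ 0 := by
  by_contra! hpos
  obtain ⟨m, hm, hmax⟩ := Finset.exists_max_image (Finset.range (K + 1)) w ⟨0, by simp⟩
  have hM : 0 < w m := hpos.trans_le (hmax j (by simp; omega))
  have key : ∀ k, k ≤ K → w m ≤ w k → False := by
    intro k
    induction k with
    | zero => intro _ h; linarith
    | succ k ih =>
      intro hk h
      have hne : k + 1 ≠ K := by
        rintro rfl
        linarith
      have h1 := hw (k + 1) (by simp; omega)
      have h2 := hmax (k + 1 + 1) (by simp; omega)
      rw [Nat.add_sub_cancel] at h1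
      exact ih (by omega) (by linarith)
  exact key m (by simp at hm; omega) le_rfl

/-- A sequence vanishing at `0` and `K` whose discrete Laplacian is bounded by `e` lies below the
parabola `e * j * (K - j)`. -/
theorem le_parabola_of_laplacian_le {K : ℕ} {D : ℕ → ℝ} {e : ℝ} (h0 : D 0 = 0) (hK : D K = 0)
    (hD : ∀ j ∈ Finset.Icc 1 (K - 1), D j ≤ e + (1 / 2) * D (j - 1) + (1 / 2) * D (j + 1))
    {j : ℕ} (hj : j ≤ K) : D j ≤ e * (j * (K - j)) := by
  suffices D j - e * (j * (K - j)) ≤ 0 by linarith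
  refine discrete_maximum_principle (w := fun j : ℕ => D j - e * (j * (K - j)))
    (by simp [h0]) (by simp [hK]) ?_ hj
  intro i hi
  have h := hD i hi
  have h1 : 1 ≤ i := (Finset.mem_Icc.mp hi).1
  push_cast [Nat.cast_sub h1]
  linarith

/-- A continuous process that is constant on the intervals where `z` is positive either has not
moved on `[0,t]`, or has not moved since a zero of `z` in `[0,t]`. -/
theorem exists_zero_and_eq_or_eq_zero {T t : ℝ} {y z : ℝ → ℝ}
    (hy : ContinuousOn y (Set.Icc 0 T)) (hz : ContinuousOn z (Set.Icc 0 T))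
    (hz0 : ∀ s ∈ Set.Icc 0 T, 0 ≤ z s)
    (hconst : ∀ a b : ℝ, 0 ≤ a → a ≤ b → b ≤ T → (∀ s ∈ Set.Icc a b, 0 < z s) →
      ∀ s ∈ Set.Icc a b, y s = y a)
    (ht : t ∈ Set.Icc 0 T) :
    y t = y 0 ∨ ∃ s ∈ Set.Icc 0 t, z s = 0 ∧ y t = y s := by
  have hsub : Set.Icc 0 t ⊆ Set.Icc 0 T := Set.Icc_subset_Icc_right ht.2
  by_cases hne : (Set.Icc 0 t ∩ z ⁻¹' {0}).Nonempty
  · right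
    have hclosed : IsClosed (Set.Icc 0 t ∩ z ⁻¹' {0}) :=
      (hz.mono hsub).preimage_isClosed_of_isClosed isClosed_Icc isClosed_singleton
    have hcomp : IsCompact (Set.Icc 0 t ∩ z ⁻¹' {0}) :=
      isCompact_Icc.of_isClosed_subset hclosed Set.inter_subset_left
    obtain ⟨s, ⟨hs, hzs⟩, hmax⟩ := hcomp.exists_isGreatest hne
    refine ⟨s, hs, hzs, ?_⟩
    rcases hs.2.eq_or_lt with rfl | hst
    · rfl
    have heq : ∀ a ∈ Set.Ioc s t, y t = y a := by
      intro a ha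
      have ha0 : 0 ≤ a := hs.1.trans ha.1.le
      refine hconst a t ha0 ha.2 ht.2 (fun r hr => ?_) t ⟨ha.2, le_rfl⟩
      have hr' : r ∈ Set.Icc 0 t := ⟨ha0.trans hr.1, hr.2⟩
      refine (hz0 r (hsub hr')).lt_of_ne fun h => ?_
      have := hmax ⟨hr', h.symm⟩
      linarith [ha.1, hr.1]
    have hlim : Filter.Tendsto y (nhdsWithin s (Set.Ioc s t)) (nhds (y s)) :=
      (hy s (hsub hs)).mono_left (nhdsWithin_mono s fun r hr =>
        hsub ⟨hs.1.trans hr.1.le, hr.2⟩)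
    have hlim' : Filter.Tendsto y (nhdsWithin s (Set.Ioc s t)) (nhds (y t)) :=
      tendsto_const_nhds.congr' (eventually_nhdsWithin_of_forall heq)
    have : (nhdsWithin s (Set.Ioc s t)).NeBot := by
      rw [nhdsWithin_Ioc_eq_nhdsGT hst]
      infer_instance
    exact tendsto_nhds_unique hlim' hlim
  · left
    refine hconst 0 t le_rfl ht.1 ht.2 (fun r hr => ?_) t ⟨ht.1, le_rfl⟩
    exact (hz0 r (hsub hr)).lt_of_ne fun h => hne ⟨r, hr, h.symm⟩

/-- One-sided comparison of the local times of two solutions of the Skorokhod problem. -/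
theorem IsSkorokhodSolution.sub_le {K : ℕ} {T : ℝ} {x x' y y' z z' : ℝ → ℕ → ℝ}
    (hsol : IsSkorokhodSolution K T x y z) (hsol' : IsSkorokhodSolution K T x' y' z')
    {j : ℕ} (hj : j ∈ Finset.Icc 1 (K - 1)) {c : ℝ} (hc : 0 ≤ c)
    (hbound : ∀ s ∈ Set.Icc 0 T, (x' s j - x s j) + (1 / 2) * (y s (j - 1) - y' s (j - 1)) +
      (1 / 2) * (y s (j + 1) - y' s (j + 1)) ≤ c)
    {t : ℝ} (ht : t ∈ Set.Icc 0 T) : y t j - y' t j ≤ c := by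
  obtain ⟨hcont, -, -, heq, hz, hmono, hconst⟩ := hsol
  obtain ⟨-, -, -, heq', hz', hmono', -⟩ := hsol'
  rcases exists_zero_and_eq_or_eq_zero (hcont j hj).1 (hcont j hj).2 (fun s hs => hz s hs j hj)
    (hconst j hj) ht with h | ⟨s, hs, hzs, h⟩
  · have h1 : y' 0 j ≤ y' t j := (hmono' j hj).1 ⟨le_rfl, ht.1.trans ht.2⟩ ht ht.1
    linarith [(hmono j hj).2, (hmono' j hj).2]
  · have hsT : s ∈ Set.Icc 0 T := ⟨hs.1, hs.2.trans ht.2⟩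
    have h1 : y' s j ≤ y' t j := (hmono' j hj).1 hsT ht hs.2
    linarith [heq s hsT j hj, heq' s hsT j hj, hz' s hsT j hj, hbound s hsT]

/-- A continuous function on `[0,T]` has bounded square. -/
theorem bddAbove_range_sq_of_continuousOn {T : ℝ} {f : ℝ → ℝ}
    (hf : ContinuousOn f (Set.Icc 0 T)) :
    BddAbove (Set.range fun t : Set.Icc (0 : ℝ) T => f t.1 ^ 2) :=
  isCompact_range ((continuousOn_iff_continuous_domRestrict.mp hf).pow 2) |>.bddAbove

/-- the local time part of the Skorokhod map for `Q^{(K−1)}` is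
Lipschitz with constant `2(K−1)^{5/2}` in the `‖·‖_{T,2}` norm. -/
theorem skorokhod_local_time_lipschitz_T2
    (K : ℕ) (hK : 2 ≤ K) (T : ℝ) (hT : 0 < T)
    (x x' y y' z z' : ℝ → ℕ → ℝ)
    (hx : ∀ j ∈ Finset.Icc 1 (K - 1), ContinuousOn (fun t => x t j) (Set.Icc 0 T))
    (hx' : ∀ j ∈ Finset.Icc 1 (K - 1), ContinuousOn (fun t => x' t j) (Set.Icc 0 T))
    (hx0 : ∀ j ∈ Finset.Icc 1 (K - 1), 0 ≤ x 0 j)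
    (hx0' : ∀ j ∈ Finset.Icc 1 (K - 1), 0 ≤ x' 0 j)
    (hsol : IsSkorokhodSolution K T x y z)
    (hsol' : IsSkorokhodSolution K T x' y' z') :
    normT2 T K (fun t j => y t j - y' t j) ≤
      2 * ((K : ℝ) - 1) ^ ((5 : ℝ) / 2) * normT2 T K (fun t j => x t j - x' t j) := by
  obtain ⟨hcy, hy0, hyK, -⟩ := id hsol
  obtain ⟨hcy', hy0', hyK', -⟩ := id hsol'
  have : Nonempty (Set.Icc (0 : ℝ) T) := ⟨⟨0, le_rfl, hT.le⟩⟩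
  set S : ℕ → ℝ := fun j => ⨆ t : Set.Icc (0 : ℝ) T, (y t.1 j - y' t.1 j) ^ 2 with hS
  set E : ℕ → ℝ := fun j => ⨆ t : Set.Icc (0 : ℝ) T, (x t.1 j - x' t.1 j) ^ 2 with hE
  have hS_nonneg : ∀ j, 0 ≤ S j := fun j => Real.iSup_nonneg fun t => sq_nonneg _
  have hE_nonneg : ∀ j, 0 ≤ E j := fun j => Real.iSup_nonneg fun t => sq_nonneg _
  have hS0 : S 0 = 0 := by simp [hS, hy0, hy0']
  have hSK : S K = 0 := by simp [hS, hyK, hyK']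
  have hyS : ∀ j ≤ K, ∀ t ∈ Set.Icc 0 T, |y t j - y' t j| ≤ √(S j) := by
    intro j hj t ht
    rcases Nat.eq_zero_or_pos j with rfl | hpos
    · simp [hy0, hy0']
    rcases hj.eq_or_lt with rfl | hlt
    · simp [hyK, hyK']
    have hmem : j ∈ Finset.Icc 1 (K - 1) := Finset.mem_Icc.mpr ⟨hpos, by omega⟩
    exact Real.abs_le_sqrt (le_ciSup (bddAbove_range_sq_of_continuousOn
      ((hcy j hmem).1.sub (hcy' j hmem).1)) ⟨t, ht⟩)
  set e : ℝ := √(∑ j ∈ Finset.Icc 1 (K - 1), E j) with he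
  have hxe : ∀ j ∈ Finset.Icc 1 (K - 1), ∀ t ∈ Set.Icc 0 T, |x t j - x' t j| ≤ e := by
    intro j hj t ht
    refine Real.abs_le_sqrt (le_trans ?_ (Finset.single_le_sum (fun i _ => hE_nonneg i) hj))
    exact le_ciSup (bddAbove_range_sq_of_continuousOn ((hx j hj).sub (hx' j hj))) ⟨t, ht⟩
  have he0 : 0 ≤ e := Real.sqrt_nonneg _
  have hD : ∀ j ∈ Finset.Icc 1 (K - 1),
      √(S j) ≤ e + (1 / 2) * √(S (j - 1)) + (1 / 2) * √(S (j + 1)) := by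
    intro j hj
    have hj' := Finset.mem_Icc.mp hj
    have hc : 0 ≤ e + (1 / 2) * √(S (j - 1)) + (1 / 2) * √(S (j + 1)) := by positivity
    refine Real.sqrt_le_iff.mpr ⟨hc, ciSup_le fun t => sq_le_sq.mpr ?_⟩
    rw [abs_of_nonneg hc]
    refine abs_sub_le_iff.mpr ⟨hsol.sub_le hsol' hj hc (fun s hs => ?_) t.2,
      hsol'.sub_le hsol hj hc (fun s hs => ?_) t.2⟩
    all_goals
      have h1 := abs_le.mp (hxe j hj s hs)
      have h2 := abs_le.mp (hyS (j - 1) (by omega) s hs)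
      have h3 := abs_le.mp (hyS (j + 1) (by omega) s hs)
      linarith [h1.1, h1.2, h2.1, h2.2, h3.1, h3.2]
  have hK2 : (2 : ℝ) ≤ K := by exact_mod_cast hK
  have hSle : ∀ j ∈ Finset.Icc 1 (K - 1), S j ≤ ((K : ℝ) - 1) ^ 4 * e ^ 2 := by
    intro j hj
    have hj' := Finset.mem_Icc.mp hj
    have h := le_parabola_of_laplacian_le (D := fun j => √(S j)) (by simp [hS0]) (by simp [hSK])
      hD (show j ≤ K by omega)
    have hpar : (j : ℝ) * (K - j) ≤ ((K : ℝ) - 1) ^ 2 := by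
      nlinarith [sq_nonneg ((K : ℝ) - 2 * j)]
    have h2 : √(S j) ≤ e * ((K : ℝ) - 1) ^ 2 := h.trans (mul_le_mul_of_nonneg_left hpar he0)
    calc S j ≤ (e * ((K : ℝ) - 1) ^ 2) ^ 2 := (Real.sqrt_le_left (by positivity)).mp h2
      _ = ((K : ℝ) - 1) ^ 4 * e ^ 2 := by ring
  have hN : (0 : ℝ) ≤ (K : ℝ) - 1 := by linarith
  have hsum : ∑ j ∈ Finset.Icc 1 (K - 1), S j ≤
      ((K : ℝ) - 1) ^ 5 * ∑ j ∈ Finset.Icc 1 (K - 1), E j := by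
    have h := Finset.sum_le_card_nsmul _ _ _ hSle
    rw [Nat.card_Icc, nsmul_eq_mul, Nat.add_sub_cancel, Nat.cast_sub (by omega), Nat.cast_one,
      he, Real.sq_sqrt (Finset.sum_nonneg fun i _ => hE_nonneg i)] at h
    linarith
  have hpow : (((K : ℝ) - 1) ^ ((5 : ℝ) / 2)) ^ 2 = ((K : ℝ) - 1) ^ 5 := by
    rw [← Real.rpow_natCast, ← Real.rpow_mul hN, ← Real.rpow_natCast]
    norm_num
  have hC : 0 ≤ ((K : ℝ) - 1) ^ ((5 : ℝ) / 2) := Real.rpow_nonneg hN _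
  have hmain : normT2 T K (fun t j => y t j - y' t j) ≤
      ((K : ℝ) - 1) ^ ((5 : ℝ) / 2) * normT2 T K (fun t j => x t j - x' t j) := by
    unfold normT2
    rw [← Real.sqrt_sq hC, ← Real.sqrt_mul (sq_nonneg _), hpow]
    refine Real.sqrt_le_sqrt ?_
    calc 1 / ((K : ℝ) - 1) * ∑ j ∈ Finset.Icc 1 (K - 1), S j
        ≤ 1 / ((K : ℝ) - 1) * (((K : ℝ) - 1) ^ 5 * ∑ j ∈ Finset.Icc 1 (K - 1), E j) :=
          mul_le_mul_of_nonneg_left hsum (by positivity)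
      _ = ((K : ℝ) - 1) ^ 5 * (1 / ((K : ℝ) - 1) * ∑ j ∈ Finset.Icc 1 (K - 1), E j) := by ring
  have hnn : 0 ≤ normT2 T K (fun t j => x t j - x' t j) := Real.sqrt_nonneg _
  linarith [mul_nonneg hC hnn]
end

section
/- Let K ≥ 2 be an integer, T > 0, and let x, x̃ ∈ C([0,T],ℝ^{K−1}) satisfy x_j(0) ≥ 0 and x̃_j(0) ≥ 0 for all j. Suppose (y,z) is a solution of the Skorokhod problem for x with reflection matrix Q^{(K−1)} and (ỹ,z̃) is a solution of the Skorokhod problem for x̃ with reflection matrix Q^{(K−1)}. Then ‖z − z̃‖_{T,2} ≤ (1 + 3√2 (K−1)^{5/2}) · ‖x − x̃‖_{T,2}. -/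
open scoped BigOperators

/-- Where the regulator `y` is nonzero, it equals its value at an earlier zero of `z`. -/
theorem eq_zero_or_exists_zero_of_complementarity {T : ℝ} {y z : ℝ → ℝ}
    (hy : ContinuousOn y (Set.Icc 0 T)) (hz : ContinuousOn z (Set.Icc 0 T))
    (hz0 : ∀ t ∈ Set.Icc 0 T, 0 ≤ z t) (hy0 : y 0 = 0)
    (hc : ∀ a b : ℝ, 0 ≤ a → a ≤ b → b ≤ T → (∀ t ∈ Set.Icc a b, 0 < z t) →
      ∀ t ∈ Set.Icc a b, y t = y a)
    {t : ℝ} (ht : t ∈ Set.Icc 0 T) :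
    y t = 0 ∨ ∃ s ∈ Set.Icc 0 t, z s = 0 ∧ y s = y t := by
  have hsub : Set.Icc 0 t ⊆ Set.Icc 0 T := Set.Icc_subset_Icc_right ht.2
  by_cases hne : (Set.Icc 0 t ∩ z ⁻¹' {0}).Nonempty
  · right
    have hcl : IsClosed (Set.Icc 0 t ∩ z ⁻¹' {0}) :=
      (hz.mono hsub).preimage_isClosed_of_isClosed isClosed_Icc isClosed_singleton
    have hcomp : IsCompact (Set.Icc 0 t ∩ z ⁻¹' {0}) :=
      isCompact_Icc.of_isClosed_subset hcl Set.inter_subset_left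
    obtain ⟨s, ⟨hs, hzs⟩, hmax⟩ := hcomp.exists_isGreatest hne
    refine ⟨s, hs, hzs, ?_⟩
    rcases hs.2.eq_or_lt with rfl | hlt
    · rfl
    have hconst : ∀ u ∈ Set.Ioo s t, y u = y t := by
      intro u hu
      refine (hc u t (hs.1.trans hu.1.le) hu.2.le ht.2 ?_ t ⟨hu.2.le, le_rfl⟩).symm
      intro v hv
      have hv' : v ∈ Set.Icc 0 t := ⟨(hs.1.trans hu.1.le).trans hv.1, hv.2⟩
      refine (hz0 v (hsub hv')).lt_of_ne fun h => ?_
      exact (hu.1.trans_le hv.1).not_ge (hmax ⟨hv', h.symm⟩)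
    have hlim : Filter.Tendsto y (nhdsWithin s (Set.Ioo s t)) (nhds (y s)) :=
      (hy s (hsub hs)).mono_left (nhdsWithin_mono s fun u hu =>
        hsub ⟨hs.1.trans hu.1.le, hu.2.le⟩)
    have : (nhdsWithin s (Set.Ioo s t)).NeBot := by
      rw [nhdsWithin_Ioo_eq_nhdsGT hlt]; infer_instance
    refine tendsto_nhds_unique hlim (tendsto_const_nhds.congr' ?_)
    filter_upwards [self_mem_nhdsWithin] with u hu using (hconst u hu).symm
  · left
    rw [← hy0]
    refine hc 0 t le_rfl ht.1 ht.2 ?_ t ⟨ht.1, le_rfl⟩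
    intro v hv
    exact (hz0 v (hsub hv)).lt_of_ne fun h => hne ⟨v, hv, h.symm⟩

theorem sum_range_mul_discrete_laplacian (a : ℕ → ℝ) (n : ℕ) :
    ∑ i ∈ Finset.range n, a (i + 1) * (2 * a (i + 1) - a i - a (i + 2)) =
      ∑ i ∈ Finset.range (n + 1), (a (i + 1) - a i) ^ 2
        + a 0 * (a 1 - a 0) - a (n + 1) * (a (n + 1) - a n) := by
  induction n with
  | zero => simp; ring
  | succ n ih => rw [Finset.sum_range_succ, ih, Finset.sum_range_succ _ (n + 1)]; ring

theorem sum_sq_le_of_zero_boundary (a : ℕ → ℝ) (n : ℕ) (h0 : a 0 = 0) :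
    2 * ∑ i ∈ Finset.range n, a (i + 1) ^ 2 ≤
      (n : ℝ) * (n + 1) * ∑ i ∈ Finset.range (n + 1), (a (i + 1) - a i) ^ 2 := by
  set D := ∑ i ∈ Finset.range (n + 1), (a (i + 1) - a i) ^ 2
  have key : ∀ i ∈ Finset.range n, a (i + 1) ^ 2 ≤ ((i : ℝ) + 1) * D := by
    intro i hi
    have h := sq_sum_le_card_mul_sum_sq (s := Finset.range (i + 1))
      (f := fun k => a (k + 1) - a k)
    rw [Finset.sum_range_sub, h0, sub_zero, Finset.card_range] at h
    push_cast at h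
    refine h.trans (mul_le_mul_of_nonneg_left ?_ (by positivity))
    refine Finset.sum_le_sum_of_subset_of_nonneg ?_ fun _ _ _ => sq_nonneg _
    rw [Finset.mem_range] at hi
    exact Finset.range_subset_range.2 (by omega)
  have hs : ∀ m : ℕ, 2 * ∑ i ∈ Finset.range m, ((i : ℝ) + 1) = m * (m + 1) := by
    intro m
    induction m with
    | zero => simp
    | succ m ih => rw [Finset.sum_range_succ, mul_add, ih]; push_cast; ring
  calc _ ≤ 2 * ∑ i ∈ Finset.range n, ((i : ℝ) + 1) * D := by
        gcongr with i hi; exact key i hi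
    _ = _ := by rw [← Finset.sum_mul, ← mul_assoc, hs]

/-- Stability in `ℓ²` of the discrete Dirichlet problem. -/
theorem sum_sq_le_of_discrete_laplacian_le (a b : ℕ → ℝ) (n : ℕ) (hn : 1 ≤ n)
    (h0 : a 0 = 0) (h1 : a (n + 1) = 0) (ha : ∀ j, 0 ≤ a j)
    (h : ∀ i ∈ Finset.range n,
      a (i + 1) ≤ b (i + 1) + (1 / 2) * a i + (1 / 2) * a (i + 2)) :
    ∑ i ∈ Finset.range n, a (i + 1) ^ 2 ≤
      ((n : ℝ) * (n + 1)) ^ 2 * ∑ i ∈ Finset.range n, b (i + 1) ^ 2 := by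
  have hn' : (1 : ℝ) ≤ n := by exact_mod_cast hn
  set N : ℝ := (n : ℝ) * (n + 1) with hN
  have hNpos : 0 < N := by positivity
  have hP := sum_sq_le_of_zero_boundary a n h0
  have hL := sum_range_mul_discrete_laplacian a n
  rw [h0, h1] at hL
  have hab : N * ∑ i ∈ Finset.range n, a (i + 1) * (2 * a (i + 1) - a i - a (i + 2)) ≤
      ∑ i ∈ Finset.range n, (a (i + 1) ^ 2 + N ^ 2 * b (i + 1) ^ 2) := by
    rw [Finset.mul_sum]
    refine Finset.sum_le_sum fun i hi => ?_
    have h2 : a (i + 1) * (2 * a (i + 1) - a i - a (i + 2)) ≤ a (i + 1) * (2 * b (i + 1)) :=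
      mul_le_mul_of_nonneg_left (by linarith [h i hi]) (ha _)
    nlinarith [mul_le_mul_of_nonneg_left h2 hNpos.le, sq_nonneg (a (i + 1) - N * b (i + 1))]
  rw [Finset.sum_add_distrib, ← Finset.mul_sum, hL] at hab
  rw [← hN] at hP
  linarith

theorem sum_sq_le_of_le_add_neighbours (a b c : ℕ → ℝ) (n : ℕ) {M : ℝ} (hM : 0 < M)
    (h0 : a 0 = 0) (h1 : a (n + 1) = 0) (hc0 : ∀ j, 0 ≤ c j)
    (hA : 4 * ∑ i ∈ Finset.range n, a (i + 1) ^ 2 ≤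
      M ^ 2 * ∑ i ∈ Finset.range n, b (i + 1) ^ 2)
    (hc : ∀ i ∈ Finset.range n,
      c (i + 1) ≤ b (i + 1) + a (i + 1) + (1 / 2) * a i + (1 / 2) * a (i + 2)) :
    ∑ i ∈ Finset.range n, c (i + 1) ^ 2 ≤
      (1 + M) ^ 2 * ∑ i ∈ Finset.range n, b (i + 1) ^ 2 := by
  have hshift₁ : ∑ i ∈ Finset.range n, a i ^ 2 ≤ ∑ i ∈ Finset.range n, a (i + 1) ^ 2 := by
    have h := Finset.sum_range_succ (fun i => a i ^ 2) n
    rw [Finset.sum_range_succ', h0] at h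
    nlinarith [sq_nonneg (a n)]
  have hshift₂ : ∑ i ∈ Finset.range n, a (i + 2) ^ 2 ≤ ∑ i ∈ Finset.range n, a (i + 1) ^ 2 := by
    have h := Finset.sum_range_succ (fun i => a (i + 1) ^ 2) n
    rw [Finset.sum_range_succ', h1] at h
    simp only [add_assoc, one_add_one_eq_two] at h
    nlinarith [sq_nonneg (a (0 + 1))]
  have hpt : ∀ i ∈ Finset.range n, M * c (i + 1) ^ 2 ≤ (M * (1 + M)) * b (i + 1) ^ 2 +
      (1 + M) * (2 * a (i + 1) ^ 2 + a i ^ 2 + a (i + 2) ^ 2) := by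
    intro i hi
    set e := a (i + 1) + (1 / 2) * a i + (1 / 2) * a (i + 2) with he
    have hsq : c (i + 1) ^ 2 ≤ (b (i + 1) + e) ^ 2 :=
      pow_le_pow_left₀ (hc0 _) (by linarith [hc i hi]) 2
    have he2 : e ^ 2 ≤ 2 * a (i + 1) ^ 2 + a i ^ 2 + a (i + 2) ^ 2 := by
      rw [he]
      nlinarith [sq_nonneg (a (i + 1) - ((1 / 2) * a i + (1 / 2) * a (i + 2))),
        sq_nonneg (a i - a (i + 2))]
    have := mul_le_mul_of_nonneg_left hsq hM.le
    have := mul_le_mul_of_nonneg_left he2 (by linarith : 0 ≤ 1 + M)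
    nlinarith [sq_nonneg (M * b (i + 1) - e)]
  have hsum := Finset.sum_le_sum hpt
  simp only [Finset.sum_add_distrib, ← Finset.mul_sum] at hsum
  have hE := mul_le_mul_of_nonneg_left
    (show 2 * ∑ i ∈ Finset.range n, a (i + 1) ^ 2 + ∑ i ∈ Finset.range n, a i ^ 2 +
        ∑ i ∈ Finset.range n, a (i + 2) ^ 2 ≤ M ^ 2 * ∑ i ∈ Finset.range n, b (i + 1) ^ 2 by
      linarith) (by linarith : 0 ≤ 1 + M)
  refine le_of_mul_le_mul_left ?_ hM
  linarith

theorem abs_le_sqrt_iSup_sq {T : ℝ} {f : ℝ → ℝ} (hf : ContinuousOn f (Set.Icc 0 T))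
    {t : ℝ} (ht : t ∈ Set.Icc 0 T) :
    |f t| ≤ Real.sqrt (⨆ s : Set.Icc (0 : ℝ) T, f s.1 ^ 2) := by
  refine Real.abs_le_sqrt (le_ciSup (f := fun s : Set.Icc (0 : ℝ) T => f s.1 ^ 2) ?_ ⟨t, ht⟩)
  have h := isCompact_Icc.bddAbove_image (hf.pow 2)
  rw [Set.image_eq_range] at h
  exact h

theorem sqrt_iSup_sq_le {T : ℝ} (hT : 0 ≤ T) {f : ℝ → ℝ} {R : ℝ}
    (h : ∀ t ∈ Set.Icc 0 T, |f t| ≤ R) :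
    Real.sqrt (⨆ s : Set.Icc (0 : ℝ) T, f s.1 ^ 2) ≤ R := by
  have h0 : (0 : ℝ) ∈ Set.Icc 0 T := ⟨le_rfl, hT⟩
  have : Nonempty (Set.Icc (0 : ℝ) T) := ⟨⟨0, h0⟩⟩
  have hR : 0 ≤ R := (abs_nonneg _).trans (h 0 h0)
  refine Real.sqrt_le_iff.2 ⟨hR, ciSup_le fun s => ?_⟩
  exact sq_le_sq' (abs_le.1 (h s.1 s.2)).1 (abs_le.1 (h s.1 s.2)).2

/-- One-sided comparison of the regulators of two Skorokhod problems. -/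
theorem IsSkorokhodSolution.regulator_sub_le {n : ℕ} {T : ℝ} {x x' y y' z z' : ℝ → ℕ → ℝ}
    (hsol : IsSkorokhodSolution (n + 1) T x y z)
    (hsol' : IsSkorokhodSolution (n + 1) T x' y' z') {i : ℕ} (hi : i ∈ Finset.range n)
    {B A₁ A₂ : ℝ} (hB : ∀ t ∈ Set.Icc 0 T, |x t (i + 1) - x' t (i + 1)| ≤ B)
    (hA₁ : ∀ t ∈ Set.Icc 0 T, |y t i - y' t i| ≤ A₁)
    (hA₂ : ∀ t ∈ Set.Icc 0 T, |y t (i + 2) - y' t (i + 2)| ≤ A₂)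
    {t : ℝ} (ht : t ∈ Set.Icc 0 T) :
    y t (i + 1) - y' t (i + 1) ≤ B + (1 / 2) * A₁ + (1 / 2) * A₂ := by
  obtain ⟨hcont, -, -, heq, hpos, hmon, hc⟩ := hsol
  obtain ⟨-, -, -, heq', hpos', hmon', -⟩ := hsol'
  have hj : i + 1 ∈ Finset.Icc 1 (n + 1 - 1) := by
    rw [Finset.mem_range] at hi
    rw [Finset.mem_Icc]; omega
  have hmono' := (hmon' _ hj).1
  rcases eq_zero_or_exists_zero_of_complementarity (hcont _ hj).1 (hcont _ hj).2
    (fun t ht => hpos t ht _ hj) (hmon _ hj).2 (hc _ hj) ht with h | ⟨s, hs, hzs, hys⟩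
  · have h' := hmono' (⟨le_rfl, ht.1.trans ht.2⟩ : (0 : ℝ) ∈ Set.Icc 0 T) ht ht.1
    simp only [(hmon' _ hj).2] at h'
    have := (abs_nonneg _).trans (hB t ht)
    have := (abs_nonneg _).trans (hA₁ t ht)
    have := (abs_nonneg _).trans (hA₂ t ht)
    linarith
  · have hsT : s ∈ Set.Icc 0 T := ⟨hs.1, hs.2.trans ht.2⟩
    have h' := hmono' hsT ht hs.2
    have e := heq s hsT _ hj
    have e' := heq' s hsT _ hj
    have p' := hpos' s hsT _ hj
    simp only [Nat.add_sub_cancel, add_assoc, one_add_one_eq_two] at e e' p' h' hzs hys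
    have := (abs_le.1 (hB s hsT)).1
    have := (abs_le.1 (hA₁ s hsT)).2
    have := (abs_le.1 (hA₂ s hsT)).2
    linarith

theorem one_add_two_mul_le_lipschitz_constant (n : ℕ) (hn : 1 ≤ n) :
    1 + 2 * ((n : ℝ) * (n + 1)) ≤ 1 + 3 * Real.sqrt 2 * (n : ℝ) ^ ((5 : ℝ) / 2) := by
  have hn' : (1 : ℝ) ≤ n := by exact_mod_cast hn
  have hp : (n : ℝ) ^ 2 ≤ (n : ℝ) ^ ((5 : ℝ) / 2) := by
    rw [← Real.rpow_natCast]
    exact Real.rpow_le_rpow_of_exponent_le hn' (by norm_num)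
  have hs : (4 : ℝ) / 3 ≤ Real.sqrt 2 := Real.le_sqrt_of_sq_le (by norm_num)
  have : 4 * (n : ℝ) ^ 2 ≤ 3 * Real.sqrt 2 * (n : ℝ) ^ ((5 : ℝ) / 2) :=
    mul_le_mul (by linarith) hp (by positivity) (by positivity)
  nlinarith

/-- the reflected path part of the Skorokhod map for `Q^{(K−1)}`
is Lipschitz with constant `1 + 3√2 (K−1)^{5/2}` in the `‖·‖_{T,2}` norm. -/
theorem skorokhod_reflected_path_lipschitz_T2
    (K : ℕ) (hK : 2 ≤ K) (T : ℝ) (hT : 0 < T)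
    (x x' y y' z z' : ℝ → ℕ → ℝ)
    (hx : ∀ j ∈ Finset.Icc 1 (K - 1), ContinuousOn (fun t => x t j) (Set.Icc 0 T))
    (hx' : ∀ j ∈ Finset.Icc 1 (K - 1), ContinuousOn (fun t => x' t j) (Set.Icc 0 T))
    (hx0 : ∀ j ∈ Finset.Icc 1 (K - 1), 0 ≤ x 0 j)
    (hx0' : ∀ j ∈ Finset.Icc 1 (K - 1), 0 ≤ x' 0 j)
    (hsol : IsSkorokhodSolution K T x y z)
    (hsol' : IsSkorokhodSolution K T x' y' z') :
    normT2 T K (fun t j => z t j - z' t j) ≤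
      (1 + 3 * Real.sqrt 2 * ((K : ℝ) - 1) ^ ((5 : ℝ) / 2)) *
        normT2 T K (fun t j => x t j - x' t j) := by
  obtain ⟨n, rfl⟩ : ∃ n, K = n + 1 := ⟨K - 1, by omega⟩
  have hn : 1 ≤ n := by omega
  have hmem : ∀ i ∈ Finset.range n, i + 1 ∈ Finset.Icc 1 (n + 1 - 1) := by
    intro i hi
    rw [Finset.mem_range] at hi
    rw [Finset.mem_Icc]; omega
  set a : ℕ → ℝ := fun j => Real.sqrt (⨆ t : Set.Icc (0 : ℝ) T, (y t.1 j - y' t.1 j) ^ 2)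
    with ha
  set b : ℕ → ℝ := fun j => Real.sqrt (⨆ t : Set.Icc (0 : ℝ) T, (x t.1 j - x' t.1 j) ^ 2)
    with hb
  set c : ℕ → ℝ := fun j => Real.sqrt (⨆ t : Set.Icc (0 : ℝ) T, (z t.1 j - z' t.1 j) ^ 2)
    with hc
  have ha0 : a 0 = 0 := by simp [ha, hsol.2.1, hsol'.2.1]
  have ha1 : a (n + 1) = 0 := by simp [ha, hsol.2.2.1, hsol'.2.2.1]
  have hB : ∀ i ∈ Finset.range n, ∀ t ∈ Set.Icc 0 T, |x t (i + 1) - x' t (i + 1)| ≤ b (i + 1) :=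
    fun i hi t ht => abs_le_sqrt_iSup_sq ((hx _ (hmem i hi)).sub (hx' _ (hmem i hi))) ht
  have hA : ∀ j ≤ n + 1, ∀ t ∈ Set.Icc 0 T, |y t j - y' t j| ≤ a j := by
    intro j hj t ht
    rcases Nat.eq_zero_or_pos j with rfl | hpos
    · simp [ha0, hsol.2.1, hsol'.2.1]
    rcases hj.eq_or_lt with rfl | hlt
    · simp [ha1, hsol.2.2.1, hsol'.2.2.1]
    have hjm : j ∈ Finset.Icc 1 (n + 1 - 1) := by rw [Finset.mem_Icc]; omega
    exact abs_le_sqrt_iSup_sq ((hsol.1 j hjm).1.sub (hsol'.1 j hjm).1) ht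
  have hlap : ∀ i ∈ Finset.range n,
      a (i + 1) ≤ b (i + 1) + (1 / 2) * a i + (1 / 2) * a (i + 2) := by
    intro i hi
    have hi' := Finset.mem_range.1 hi
    refine sqrt_iSup_sq_le (f := fun t => y t (i + 1) - y' t (i + 1)) hT.le
      fun t ht => abs_sub_le_iff.2 ⟨?_, ?_⟩
    · exact hsol.regulator_sub_le hsol' hi (hB i hi) (hA i (by omega)) (hA (i + 2) (by omega)) ht
    · refine hsol'.regulator_sub_le hsol hi ?_ ?_ ?_ ht
      · intro s hs; rw [abs_sub_comm]; exact hB i hi s hs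
      · intro s hs; rw [abs_sub_comm]; exact hA i (by omega) s hs
      · intro s hs; rw [abs_sub_comm]; exact hA (i + 2) (by omega) s hs
  have hcle : ∀ i ∈ Finset.range n,
      c (i + 1) ≤ b (i + 1) + a (i + 1) + (1 / 2) * a i + (1 / 2) * a (i + 2) := by
    intro i hi
    have hi' := Finset.mem_range.1 hi
    refine sqrt_iSup_sq_le (f := fun t => z t (i + 1) - z' t (i + 1)) hT.le fun t ht => ?_
    have e := hsol.2.2.2.1 t ht _ (hmem i hi)
    have e' := hsol'.2.2.2.1 t ht _ (hmem i hi)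
    simp only [Nat.add_sub_cancel, add_assoc, one_add_one_eq_two] at e e'
    have h1 := abs_le.1 (hB i hi t ht)
    have h2 := abs_le.1 (hA i (by omega) t ht)
    have h3 := abs_le.1 (hA (i + 1) (by omega) t ht)
    have h4 := abs_le.1 (hA (i + 2) (by omega) t ht)
    rw [abs_le]
    constructor <;> linarith [h1.1, h1.2, h2.1, h2.2, h3.1, h3.2, h4.1, h4.2]
  have hn' : (1 : ℝ) ≤ n := by exact_mod_cast hn
  have hAB := sum_sq_le_of_discrete_laplacian_le a b n hn ha0 ha1 (fun _ => Real.sqrt_nonneg _) hlap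
  have hmain := sum_sq_le_of_le_add_neighbours a b c n (M := 2 * ((n : ℝ) * (n + 1)))
    (by positivity) ha0 ha1 (fun _ => Real.sqrt_nonneg _) (by linarith) hcle
  have hnorm : ∀ f : ℝ → ℕ → ℝ, normT2 T (n + 1) f = Real.sqrt ((1 / (n : ℝ)) *
      ∑ i ∈ Finset.range n, Real.sqrt (⨆ t : Set.Icc (0 : ℝ) T, f t.1 (i + 1) ^ 2) ^ 2) := by
    intro f
    unfold normT2
    have hI : Finset.Icc 1 (n + 1 - 1) = Finset.Ico 1 (n + 1) := by
      ext j; simp only [Finset.mem_Icc, Finset.mem_Ico]; omega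
    rw [hI, Finset.sum_Ico_eq_sum_range]
    simp only [Nat.add_sub_cancel, Nat.cast_add, Nat.cast_one, add_sub_cancel_right, add_comm 1]
    refine congrArg _ (congrArg _ (Finset.sum_congr rfl fun i _ => ?_))
    exact (Real.sq_sqrt (Real.iSup_nonneg fun _ => sq_nonneg _)).symm
  rw [hnorm, hnorm, Nat.cast_add, Nat.cast_one, add_sub_cancel_right]
  refine le_trans ?_ (mul_le_mul_of_nonneg_right
    (one_add_two_mul_le_lipschitz_constant n hn) (Real.sqrt_nonneg _))
  refine Real.sqrt_le_iff.2 ⟨by positivity, ?_⟩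
  rw [mul_pow, Real.sq_sqrt (mul_nonneg (by positivity) (Finset.sum_nonneg fun _ _ => sq_nonneg _)),
    mul_left_comm]
  exact mul_le_mul_of_nonneg_left hmain (by positivity)
end

section
/- The logarithm of the standard normal upper tail is strictly concave on (0,∞): for every y > 0 one has the identity (log Φ̄)''(y) = (y − φ(y)/Φ̄(y)) · (φ(y)/Φ̄(y)) < 0, and consequently for all a, b > 0, Φ̄((a+b)/2) ≥ √(Φ̄(a) · Φ̄(b)). -/
/-- The standard normal density `φ(y) = (2π)^{−1/2} e^{−y²/2}`. -/
noncomputable def stdGaussianPDF (y : ℝ) : ℝ :=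
  (Real.sqrt (2 * Real.pi))⁻¹ * Real.exp (-y ^ 2 / 2)

/-- The standard normal upper tail `Φ̄(y) = ∫_y^∞ φ(z) dz`. -/
noncomputable def stdGaussianTail (y : ℝ) : ℝ :=
  ∫ z in Set.Ioi y, stdGaussianPDF z

theorem stdGaussianPDF_pos (y : ℝ) : 0 < stdGaussianPDF y := by
  unfold stdGaussianPDF
  positivity

theorem hasDerivAt_stdGaussianPDF (y : ℝ) :
    HasDerivAt stdGaussianPDF (-y * stdGaussianPDF y) y := by
  have h : HasDerivAt (fun x : ℝ => -x ^ 2 / 2) (-y) y := by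
    refine ((hasDerivAt_pow 2 y).fun_neg.div_const 2).congr_deriv ?_
    norm_num
    ring
  refine (h.exp.const_mul (Real.sqrt (2 * Real.pi))⁻¹).congr_deriv ?_
  unfold stdGaussianPDF
  ring

theorem continuous_stdGaussianPDF : Continuous stdGaussianPDF :=
  continuous_iff_continuousAt.2 fun y => (hasDerivAt_stdGaussianPDF y).continuousAt

theorem integrable_stdGaussianPDF : MeasureTheory.Integrable stdGaussianPDF := by
  convert (integrable_exp_neg_mul_sq (b := 1 / 2) (by norm_num)).const_mul
    (Real.sqrt (2 * Real.pi))⁻¹ using 2 with y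
  unfold stdGaussianPDF
  ring_nf

theorem integrable_mul_stdGaussianPDF :
    MeasureTheory.Integrable fun z => z * stdGaussianPDF z := by
  convert (integrable_mul_exp_neg_mul_sq (b := 1 / 2) (by norm_num)).const_mul
    (Real.sqrt (2 * Real.pi))⁻¹ using 2 with y
  unfold stdGaussianPDF
  ring_nf

theorem tendsto_stdGaussianPDF_atTop :
    Filter.Tendsto stdGaussianPDF Filter.atTop (nhds 0) := by
  have h : Filter.Tendsto (fun x : ℝ => -x ^ 2 / 2) Filter.atTop Filter.atBot := by
    have := (Filter.tendsto_pow_atTop (α := ℝ) two_ne_zero).atTop_div_const (two_pos (α := ℝ))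
    simpa only [neg_div, Function.comp_def] using Filter.tendsto_neg_atTop_atBot.comp this
  have h' := (Real.tendsto_exp_atBot.comp h).const_mul (Real.sqrt (2 * Real.pi))⁻¹
  rw [mul_zero] at h'
  exact h'

theorem integral_Ioi_mul_stdGaussianPDF (y : ℝ) :
    ∫ z in Set.Ioi y, z * stdGaussianPDF z = stdGaussianPDF y := by
  have h := MeasureTheory.integral_Ioi_of_hasDerivAt_of_tendsto'
    (f := fun z => -stdGaussianPDF z) (f' := fun z => z * stdGaussianPDF z) (a := y)
    (fun z _ => by simpa using (hasDerivAt_stdGaussianPDF z).fun_neg)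
    integrable_mul_stdGaussianPDF.integrableOn tendsto_stdGaussianPDF_atTop.neg
  simpa using h

/-- A function positive on `(y, ∞)` and integrable there has positive integral. -/
theorem setIntegral_Ioi_pos {f : ℝ → ℝ} {y : ℝ} (hf : ∀ z, y < z → 0 < f z)
    (hi : MeasureTheory.IntegrableOn f (Set.Ioi y)) : 0 < ∫ z in Set.Ioi y, f z := by
  rw [MeasureTheory.setIntegral_pos_iff_support_of_nonneg_ae _ hi]
  · rw [Set.inter_eq_right.2 (show Set.Ioi y ⊆ Function.support f from
      fun z hz => (hf z hz).ne')]
    simp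
  · filter_upwards [MeasureTheory.ae_restrict_mem measurableSet_Ioi] with z hz
    exact (hf z hz).le

theorem stdGaussianTail_pos (y : ℝ) : 0 < stdGaussianTail y :=
  setIntegral_Ioi_pos (fun z _ => stdGaussianPDF_pos z) integrable_stdGaussianPDF.integrableOn

/-- The Mills ratio bound `y Φ̄(y) < φ(y)`. -/
theorem mul_stdGaussianTail_lt (y : ℝ) : y * stdGaussianTail y < stdGaussianPDF y := by
  have h : 0 < ∫ z in Set.Ioi y, (z * stdGaussianPDF z - y * stdGaussianPDF z) :=
    setIntegral_Ioi_pos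
      (fun z hz => sub_pos.2 (mul_lt_mul_of_pos_right hz (stdGaussianPDF_pos z)))
      (integrable_mul_stdGaussianPDF.sub (integrable_stdGaussianPDF.const_mul y)).integrableOn
  rw [MeasureTheory.integral_sub integrable_mul_stdGaussianPDF.integrableOn
    (integrable_stdGaussianPDF.const_mul y).integrableOn,
    integral_Ioi_mul_stdGaussianPDF, MeasureTheory.integral_const_mul] at h
  exact sub_pos.1 h

theorem hasDerivAt_stdGaussianTail (y : ℝ) :
    HasDerivAt stdGaussianTail (-stdGaussianPDF y) y := by
  have h : stdGaussianTail =
      fun u => stdGaussianTail 0 - ∫ z in (0 : ℝ)..u, stdGaussianPDF z := by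
    funext u
    have := intervalIntegral.integral_interval_add_Ioi (a := 0) (b := u)
      integrable_stdGaussianPDF.integrableOn integrable_stdGaussianPDF.integrableOn
    unfold stdGaussianTail
    linarith
  rw [h]
  exact (continuous_stdGaussianPDF.integral_hasStrictDerivAt 0 y).hasDerivAt.const_sub _

theorem hasDerivAt_log_stdGaussianTail (y : ℝ) :
    HasDerivAt (fun u => Real.log (stdGaussianTail u))
      (-stdGaussianPDF y / stdGaussianTail y) y :=
  (hasDerivAt_stdGaussianTail y).log (stdGaussianTail_pos y).ne'

theorem deriv_deriv_log_stdGaussianTail (y : ℝ) :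
    deriv (deriv fun u => Real.log (stdGaussianTail u)) y =
      (y - stdGaussianPDF y / stdGaussianTail y) *
        (stdGaussianPDF y / stdGaussianTail y) := by
  rw [funext fun u => (hasDerivAt_log_stdGaussianTail u).deriv]
  have hne := (stdGaussianTail_pos y).ne'
  refine (((hasDerivAt_stdGaussianPDF y).neg.div
    (hasDerivAt_stdGaussianTail y) hne).deriv).trans ?_
  simp only [Pi.neg_apply]
  field_simp

theorem deriv_deriv_log_stdGaussianTail_neg (y : ℝ) :
    deriv (deriv fun u => Real.log (stdGaussianTail u)) y < 0 := by
  rw [deriv_deriv_log_stdGaussianTail]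
  have ht := stdGaussianTail_pos y
  exact mul_neg_of_neg_of_pos
    (sub_neg.2 ((lt_div_iff₀ ht).2 (mul_stdGaussianTail_lt y)))
    (div_pos (stdGaussianPDF_pos y) ht)

theorem strictConcaveOn_log_stdGaussianTail :
    StrictConcaveOn ℝ Set.univ fun y => Real.log (stdGaussianTail y) :=
  strictConcaveOn_of_deriv2_neg convex_univ
    (fun y _ => (hasDerivAt_log_stdGaussianTail y).continuousAt.continuousWithinAt)
    fun y _ => deriv_deriv_log_stdGaussianTail_neg y

theorem sqrt_stdGaussianTail_mul_le (a b : ℝ) :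
    Real.sqrt (stdGaussianTail a * stdGaussianTail b) ≤ stdGaussianTail ((a + b) / 2) := by
  have ha := stdGaussianTail_pos a
  have hb := stdGaussianTail_pos b
  have h := strictConcaveOn_log_stdGaussianTail.concaveOn.2 (Set.mem_univ a) (Set.mem_univ b)
    one_half_pos.le one_half_pos.le (add_halves 1)
  simp only [smul_eq_mul] at h
  rw [show 1 / 2 * a + 1 / 2 * b = (a + b) / 2 by ring] at h
  rw [← Real.log_le_log_iff (Real.sqrt_pos.2 (mul_pos ha hb)) (stdGaussianTail_pos _),
    Real.log_sqrt (mul_pos ha hb).le, Real.log_mul ha.ne' hb.ne']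
  linarith

/-- `log Φ̄` is strictly concave on `(0,∞)`, with
`(log Φ̄)''(y) = (y − φ(y)/Φ̄(y)) (φ(y)/Φ̄(y)) < 0`, and consequently
`Φ̄((a+b)/2) ≥ √(Φ̄(a) Φ̄(b))` for all `a, b > 0`. -/
theorem log_gaussian_tail_strictConcave :
    StrictConcaveOn ℝ (Set.Ioi 0) (fun y => Real.log (stdGaussianTail y)) ∧
    (∀ y : ℝ, 0 < y →
      deriv (deriv fun u => Real.log (stdGaussianTail u)) y =
        (y - stdGaussianPDF y / stdGaussianTail y) *
          (stdGaussianPDF y / stdGaussianTail y) ∧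
      deriv (deriv fun u => Real.log (stdGaussianTail u)) y < 0) ∧
    (∀ a b : ℝ, 0 < a → 0 < b →
      Real.sqrt (stdGaussianTail a * stdGaussianTail b) ≤
        stdGaussianTail ((a + b) / 2)) := by
  exact ⟨strictConcaveOn_log_stdGaussianTail.subset (Set.subset_univ _) (convex_Ioi 0),
    fun y _ => ⟨deriv_deriv_log_stdGaussianTail y, deriv_deriv_log_stdGaussianTail_neg y⟩,
    fun a b _ _ => sqrt_stdGaussianTail_mul_le a b⟩
end
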